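/- arXiv:1612.08769 — 2 statements merged into one kernel-verified Lean document; each statement's English description precedes it below -/
import Mathlib

section
/- Let G be a finite group with exactly 5 conjugacy classes. Then G is isomorphic to exactly one of: the cyclic group Z/5, the dihedral group of order 8, the quaternion group Q8 of order 8, the dihedral group of order 14, the Frobenius group of order 20 (a semidirect product Z/5 ⋊ Z/4 with faithful action), the nonabelian group of order 21 (a semidirect product Z/7 ⋊ Z/3 with nontrivial action), the symmetric group S4, or the alternating group A5. Conversely, each of these eight groups has exactly 5 conjugacy classes. -/
/-- The eight candidate isomorphism types for a finite group with exactly `5` conjugacy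
classes: `ℤ/5`, the dihedral group of order `8`, the quaternion group `Q₈`, the dihedral
group of order `14`, the Frobenius group of order `20` (a semidirect product
`ℤ/5 ⋊ ℤ/4` with faithful action), the nonabelian group of order `21` (a semidirect
product `ℤ/7 ⋊ ℤ/3` with nontrivial action), the symmetric group `S₄`, and the
alternating group `A₅`. -/
def fiveClassOptions (G : Type) [Group G] : Fin 8 → Prop :=
  ![Nonempty (G ≃* Multiplicative (ZMod 5)),
    Nonempty (G ≃* DihedralGroup 4),
    Nonempty (G ≃* QuaternionGroup 2),
    Nonempty (G ≃* DihedralGroup 7),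
    (∃ φ : Multiplicative (ZMod 4) →* MulAut (Multiplicative (ZMod 5)),
      Function.Injective φ ∧
        Nonempty (G ≃* (Multiplicative (ZMod 5) ⋊[φ] Multiplicative (ZMod 4)))),
    (∃ φ : Multiplicative (ZMod 3) →* MulAut (Multiplicative (ZMod 7)),
      φ ≠ 1 ∧
        Nonempty (G ≃* (Multiplicative (ZMod 7) ⋊[φ] Multiplicative (ZMod 3)))),
    Nonempty (G ≃* Equiv.Perm (Fin 4)),
    Nonempty (G ≃* alternatingGroup (Fin 5))]

theorem comm_count (G : Type) [Group G] [Fintype G] [DecidableEq G] (k : ℕ)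
    (h : Fintype.card {p : G × G // p.1 * p.2 = p.2 * p.1} = k * Fintype.card G) :
    Nat.card (ConjClasses G) = k := by
  have h1 := card_comm_eq_card_conjClasses_mul_card G
  have h2 : Nat.card { p : G × G // Commute p.1 p.2 } = k * Nat.card G := by
    rw [Nat.card_eq_fintype_card (α := G), ← h, ← Nat.card_eq_fintype_card]
    rfl
  rw [h1] at h2
  exact Nat.eq_of_mul_eq_mul_right Nat.card_pos h2

theorem k_s4 : Nat.card (ConjClasses (Equiv.Perm (Fin 4))) = 5 := by
  apply comm_count
  decide +kernel
theorem k_d4 : Nat.card (ConjClasses (DihedralGroup 4)) = 5 := by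
  apply comm_count
  decide +kernel
theorem k_q8 : Nat.card (ConjClasses (QuaternionGroup 2)) = 5 := by
  apply comm_count
  decide +kernel
theorem k_d7 : Nat.card (ConjClasses (DihedralGroup 7)) = 5 := by
  rw [DihedralGroup.card_conjClasses_odd (by decide)]
theorem k_z5 : Nat.card (ConjClasses (Multiplicative (ZMod 5))) = 5 := by
  rw [← Nat.card_congr (ConjClasses.mkEquiv (α := Multiplicative (ZMod 5)))]
  simp

theorem aut_mul {p m : ℕ} [NeZero p] [NeZero m]
    (φ : Multiplicative (ZMod m) →* MulAut (Multiplicative (ZMod p))) :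
    ∃ u : ZMod p, u ^ m = 1 ∧ ∀ i x, φ i x = Multiplicative.ofAdd (u ^ (i.toAdd.val) * x.toAdd) := by
  set u : ZMod p := (φ (Multiplicative.ofAdd 1) (Multiplicative.ofAdd 1)).toAdd with hu
  have h1 : ∀ x : Multiplicative (ZMod p), φ (Multiplicative.ofAdd 1) x =
      Multiplicative.ofAdd (u * x.toAdd) := by
    intro x
    have hx : x = (Multiplicative.ofAdd (1 : ZMod p)) ^ (x.toAdd.val) := by
      rw [← ofAdd_nsmul]; simp
    conv_lhs => rw [hx, map_pow]
    apply Multiplicative.toAdd.injective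
    rw [toAdd_pow, ← hu]
    simp [mul_comm]
  have h2 : ∀ (k : ℕ) (x : Multiplicative (ZMod p)), φ (Multiplicative.ofAdd 1 ^ k) x =
      Multiplicative.ofAdd (u ^ k * x.toAdd) := by
    intro k
    induction k with
    | zero => intro x; simp
    | succ k ih =>
      intro x
      rw [pow_succ, map_mul, MulAut.mul_apply, h1, ih]
      simp [pow_succ, mul_assoc]
  refine ⟨u, ?_, ?_⟩
  · have := h2 m (Multiplicative.ofAdd 1)
    have h3 : (Multiplicative.ofAdd (1 : ZMod m)) ^ m = 1 := by
      rw [← ofAdd_nsmul]; simp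
    rw [h3, map_one] at this
    simpa using this.symm
  · intro i x
    rw [← h2]
    congr 2
    rw [← ofAdd_nsmul]; simp

theorem semi_count {p m : ℕ} [NeZero p] [NeZero m]
    (φ : Multiplicative (ZMod m) →* MulAut (Multiplicative (ZMod p))) (u : ZMod p)
    (hu : ∀ i x, φ i x = Multiplicative.ofAdd (u ^ (i.toAdd.val) * x.toAdd)) (k : ℕ)
    (h : Fintype.card {q : (ZMod p × ZMod m) × (ZMod p × ZMod m) //
      q.1.1 + u ^ q.1.2.val * q.2.1 = q.2.1 + u ^ q.2.2.val * q.1.1} = k * (p * m)) :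
    Nat.card (ConjClasses (Multiplicative (ZMod p) ⋊[φ] Multiplicative (ZMod m))) = k := by
  have h1 := card_comm_eq_card_conjClasses_mul_card
    (Multiplicative (ZMod p) ⋊[φ] Multiplicative (ZMod m))
  have hc : Nat.card (Multiplicative (ZMod p) ⋊[φ] Multiplicative (ZMod m)) = p * m := by
    simp [SemidirectProduct.card]
  let e : (Multiplicative (ZMod p) ⋊[φ] Multiplicative (ZMod m)) ≃ ZMod p × ZMod m :=
    SemidirectProduct.equivProd.trans
      (Equiv.prodCongr Multiplicative.toAdd Multiplicative.toAdd)
  have h2 : Nat.card { q : (Multiplicative (ZMod p) ⋊[φ] Multiplicative (ZMod m)) ×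
      (Multiplicative (ZMod p) ⋊[φ] Multiplicative (ZMod m)) // Commute q.1 q.2 } = k * (p * m) := by
    rw [← h, ← Nat.card_eq_fintype_card]
    refine Nat.card_congr (Equiv.subtypeEquiv (Equiv.prodCongr e e) ?_)
    rintro ⟨⟨a, b⟩, ⟨c, d⟩⟩
    simp only [Commute, SemiconjBy, SemidirectProduct.ext_iff, SemidirectProduct.mul_left,
      SemidirectProduct.mul_right, hu, mul_comm d b, and_true]
    exact Iff.rfl
  rw [h1, hc] at h2
  exact Nat.eq_of_mul_eq_mul_right (Nat.mul_pos (NeZero.pos p) (NeZero.pos m)) h2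

theorem k_f20 (φ : Multiplicative (ZMod 4) →* MulAut (Multiplicative (ZMod 5)))
    (hφ : Function.Injective φ) :
    Nat.card (ConjClasses (Multiplicative (ZMod 5) ⋊[φ] Multiplicative (ZMod 4))) = 5 := by
  obtain ⟨u, h4, hu⟩ := aut_mul φ
  have h2 : u ^ 2 ≠ 1 := by
    intro h2
    have : (Multiplicative.ofAdd (2 : ZMod 4)) = 1 := by
      apply hφ
      ext x
      rw [hu]
      have h : (Multiplicative.toAdd (Multiplicative.ofAdd (2 : ZMod 4))).val = 2 := rfl
      rw [h, h2]; simp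
    exact absurd this (by decide)
  apply semi_count φ u hu
  clear hu hφ φ
  revert u
  decide +kernel

theorem k_f21 (φ : Multiplicative (ZMod 3) →* MulAut (Multiplicative (ZMod 7)))
    (hφ : φ ≠ 1) :
    Nat.card (ConjClasses (Multiplicative (ZMod 7) ⋊[φ] Multiplicative (ZMod 3))) = 5 := by
  obtain ⟨u, h4, hu⟩ := aut_mul φ
  have h2 : u ≠ 1 := by
    rintro rfl
    apply hφ
    refine MonoidHom.ext fun i => MulEquiv.ext fun x => ?_
    rw [hu]; simp
  apply semi_count φ u hu
  clear hu hφ φ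
  revert u
  decide +kernel


section basics
variable {G : Type} [Group G]

/-- The centralizer of an element. -/
abbrev cz (g : G) : Subgroup G := Subgroup.centralizer {g}

/-- The order of the centralizer of an element. -/
noncomputable abbrev mz (g : G) : ℕ := Nat.card (cz g)

theorem mem_cz {g x : G} : x ∈ cz g ↔ x * g = g * x := by
  rw [Subgroup.mem_centralizer_singleton_iff]

theorem self_mem_cz (g : G) : g ∈ cz g := mem_cz.2 rfl

theorem mem_cz_comm {g x : G} : x ∈ cz g ↔ g ∈ cz x := by
  rw [mem_cz, mem_cz]; exact eq_comm

theorem conj_orbit (H : Subgroup G) (x : G) :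
    {y | ∃ h ∈ H, h * x * h⁻¹ = y}.ncard * Nat.card (H ⊓ cz x : Subgroup G) = Nat.card H := by
  letI : MulAction H G := MulAction.compHom G ((MulAut.conj (G := G)).comp H.subtype)
  have hs : ∀ (h : H) (y : G), h • y = (h : G) * y * (h : G)⁻¹ := fun h y => rfl
  have h1 := (MulAction.stabilizer H x).card_mul_index
  rw [MulAction.index_stabilizer] at h1
  have h2 : MulAction.orbit H x = {y | ∃ h ∈ H, h * x * h⁻¹ = y} := by
    ext y
    rw [MulAction.mem_orbit_iff]
    constructor
    · rintro ⟨h, rfl⟩; exact ⟨h, h.2, rfl⟩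
    · rintro ⟨h, hh, rfl⟩; exact ⟨⟨h, hh⟩, rfl⟩
  have h3 : Nat.card (MulAction.stabilizer H x) = Nat.card (H ⊓ cz x : Subgroup G) := by
    refine Nat.card_congr ⟨fun y => ⟨y.1.1, y.1.2, ?_⟩, fun y => ⟨⟨y.1, y.2.1⟩, ?_⟩,
      fun y => rfl, fun y => rfl⟩
    · have := y.2
      rw [MulAction.mem_stabilizer_iff, hs, mul_inv_eq_iff_eq_mul] at this
      exact mem_cz.2 this
    · have := mem_cz.1 y.2.2
      rw [MulAction.mem_stabilizer_iff, hs, mul_inv_eq_iff_eq_mul]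
      exact this
  rw [h2, h3, mul_comm] at h1
  exact h1

theorem class_card (x : G) : {y | IsConj x y}.ncard * mz x = Nat.card G := by
  have := conj_orbit (⊤ : Subgroup G) x
  rw [top_inf_eq, Subgroup.card_top] at this
  rw [← this]
  congr 2
  ext y
  simp [isConj_iff]

theorem mz_conj [Finite G] {x y : G} (h : IsConj x y) : mz x = mz y := by
  have h1 := class_card x
  have h2 := class_card y
  have h3 : {z | IsConj x z} = {z | IsConj y z} := by
    ext z
    exact ⟨fun hz => h.symm.trans hz, fun hz => h.trans hz⟩
  rw [h3, ← h2] at h1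
  refine Nat.eq_of_mul_eq_mul_left ?_ h1
  rw [Set.ncard_pos]
  exact ⟨y, IsConj.refl y⟩

theorem orderOf_dvd_mz (x : G) : orderOf x ∣ mz x := by
  have := orderOf_dvd_natCard (⟨x, self_mem_cz x⟩ : cz x)
  rwa [Subgroup.orderOf_mk] at this

theorem orderOf_dvd_mz' {x y : G} (h : y ∈ cz x) : orderOf y ∣ mz x := by
  have := orderOf_dvd_natCard (⟨y, h⟩ : cz x)
  rwa [Subgroup.orderOf_mk] at this

/-- Structure of a group with five classes, sorted by centralizer order. -/
structure Five (G : Type) [Group G] (a b c d : G) : Prop where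
  cover : ∀ x : G, x ≠ 1 → IsConj a x ∨ IsConj b x ∨ IsConj c x ∨ IsConj d x
  a1 : a ≠ 1
  b1 : b ≠ 1
  c1 : c ≠ 1
  d1 : d ≠ 1
  ab : ¬ IsConj a b
  ac : ¬ IsConj a c
  ad : ¬ IsConj a d
  bc : ¬ IsConj b c
  bd : ¬ IsConj b d
  cd : ¬ IsConj c d
  hab : mz a ≤ mz b
  hbc : mz b ≤ mz c
  hcd : mz c ≤ mz d
  sum : Nat.card G = 1 + {y | IsConj a y}.ncard + {y | IsConj b y}.ncard +
    {y | IsConj c y}.ncard + {y | IsConj d y}.ncard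

theorem exists_five [Finite G] (h : Nat.card (ConjClasses G) = 5) :
    ∃ a b c d : G, Five G a b c d := by
  classical
  haveI := Fintype.ofFinite G
  haveI := Fintype.ofFinite (ConjClasses G)
  have h4 : Fintype.card {c : ConjClasses G // c ≠ 1} = 4 := by
    rw [Fintype.card_subtype_compl, Fintype.card_subtype_eq, ← Nat.card_eq_fintype_card, h]
  let e0 := (Fintype.equivFinOfCardEq h4).symm
  let f : Fin 4 → ℕ := fun i => mz (Quotient.out (e0 i).1)
  let e := (Tuple.sort f).trans e0
  let g : Fin 4 → G := fun i => Quotient.out (e i).1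
  have hmono : Monotone fun i => mz (g i) := Tuple.monotone_sort f
  have hg : ∀ i, ConjClasses.mk (g i) = (e i).1 := fun i => Quotient.out_eq _
  have hne : ∀ i, g i ≠ 1 := by
    intro i hi
    have := hg i
    rw [hi] at this
    exact (e i).2 this.symm
  have hinj : ∀ i j, IsConj (g i) (g j) → i = j := by
    intro i j hij
    rw [← ConjClasses.mk_eq_mk_iff_isConj, hg, hg] at hij
    exact e.injective (Subtype.ext hij)
  have hcov : ∀ x : G, x ≠ 1 → ∃ i, IsConj (g i) x := by
    intro x hx
    have : ConjClasses.mk x ≠ 1 := by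
      intro h1
      rw [ConjClasses.one_eq_mk_one, ConjClasses.mk_eq_mk_iff_isConj, isConj_one_left] at h1
      exact hx h1
    obtain ⟨i, hi⟩ := e.surjective ⟨_, this⟩
    refine ⟨i, ?_⟩
    rw [← ConjClasses.mk_eq_mk_iff_isConj, hg, hi]
  refine ⟨g 0, g 1, g 2, g 3, ?_, hne _, hne _, hne _, hne _, ?_, ?_, ?_, ?_, ?_, ?_,
    hmono (by decide), hmono (by decide), hmono (by decide), ?_⟩
  · intro x hx
    obtain ⟨i, hi⟩ := hcov x hx
    fin_cases i
    · exact Or.inl hi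
    · exact Or.inr (Or.inl hi)
    · exact Or.inr (Or.inr (Or.inl hi))
    · exact Or.inr (Or.inr (Or.inr hi))
  any_goals
    intro hh
    have := hinj _ _ hh
    revert this
    decide
  · have hs := Group.sum_card_conj_classes_eq_card G
    rw [finsum_eq_sum_of_fintype, Fintype.sum_eq_add_sum_subtype_ne _ (1 : ConjClasses G),
      ← Equiv.sum_comp e, Fin.sum_univ_four] at hs
    have hcar : ∀ i, ((e i).1).carrier = {y | IsConj (g i) y} := by
      intro i
      ext y
      rw [ConjClasses.mem_carrier_iff_mk_eq, ← hg, ConjClasses.mk_eq_mk_iff_isConj]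
      exact isConj_comm
    have hone : (1 : ConjClasses G).carrier = {1} := by
      ext y
      rw [ConjClasses.mem_carrier_iff_mk_eq, ConjClasses.one_eq_mk_one,
        ConjClasses.mk_eq_mk_iff_isConj, isConj_one_left]
      rfl
    rw [hone, Set.ncard_singleton, hcar, hcar, hcar, hcar] at hs
    rw [← hs]; ring
end basics


section models
variable {G : Type} [Group G]

theorem zpow_val_add {k : ℕ} [NeZero k] {r : G} (hr : orderOf r = k) (i j : ZMod k) :
    r ^ ((i + j).val) = r ^ i.val * r ^ j.val := by
  rw [ZMod.val_add, ← pow_add]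
  have := pow_mod_orderOf r (i.val + j.val)
  rwa [hr] at this

theorem zpow_val_sub {k : ℕ} [NeZero k] {r : G} (hr : orderOf r = k) (i j : ZMod k) :
    r ^ ((j - i).val) = (r ^ i.val)⁻¹ * r ^ j.val := by
  rw [eq_inv_mul_iff_mul_eq, ← zpow_val_add hr]
  congr 2; ring

theorem zpow_val_inj {k : ℕ} [NeZero k] {r : G} (hr : orderOf r = k) (i : ZMod k)
    (h : r ^ i.val = 1) : i = 0 := by
  have h1 := orderOf_dvd_of_pow_eq_one h
  rw [hr] at h1
  have h2 := Nat.eq_zero_of_dvd_of_lt h1 (ZMod.val_lt i)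
  exact (ZMod.val_eq_zero i).1 h2

theorem pow_swap {r s : G} (h : r * s = s * r⁻¹) (m : ℕ) : r ^ m * s = s * (r ^ m)⁻¹ := by
  have h1 : SemiconjBy s r⁻¹ r := h.symm
  have h2 := h1.pow_right m
  rw [inv_pow] at h2
  exact h2.symm

theorem dihedral_of {k : ℕ} [NeZero k] [Finite G] (r s : G) (hr : orderOf r = k) (hs : s * s = 1)
    (hrs : r * s = s * r⁻¹) (hns : s ∉ Subgroup.zpowers r) (hc : Nat.card G = 2 * k) :
    Nonempty (G ≃* DihedralGroup k) := by
  let f : DihedralGroup k → G := fun x => match x with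
    | .r i => r ^ i.val
    | .sr i => s * r ^ i.val
  have hf : ∀ x y, f (x * y) = f x * f y := by
    rintro (i | i) (j | j)
    · exact zpow_val_add hr i j
    · change s * r ^ (j - i).val = r ^ i.val * (s * r ^ j.val)
      rw [zpow_val_sub hr, ← mul_assoc, ← mul_assoc, pow_swap hrs]
    · change s * r ^ (i + j).val = (s * r ^ i.val) * (r ^ j.val)
      rw [zpow_val_add hr, mul_assoc]
    · change r ^ (j - i).val = (s * r ^ i.val) * (s * r ^ j.val)
      rw [zpow_val_sub hr, mul_assoc, ← mul_assoc _ s, pow_swap hrs, ← mul_assoc, ← mul_assoc,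
        hs, one_mul]
  let F : DihedralGroup k →* G := MonoidHom.mk' f hf
  have hinj : Function.Injective F := by
    rw [injective_iff_map_eq_one]
    rintro (i | i) h
    · change r ^ i.val = 1 at h
      rw [zpow_val_inj hr i h]; rfl
    · change s * r ^ i.val = 1 at h
      exfalso
      apply hns
      rw [mul_eq_one_iff_eq_inv] at h
      rw [h]
      exact Subgroup.inv_mem _ (Subgroup.pow_mem _ (Subgroup.mem_zpowers r) _)
  have hb : Function.Bijective F := by
    refine (Nat.bijective_iff_injective_and_card F).2 ⟨hinj, ?_⟩
    rw [hc, DihedralGroup.nat_card]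
  exact ⟨(MulEquiv.ofBijective F hb).symm⟩

theorem quaternion_of [Finite G] (r s : G) (hr : orderOf r = 4) (hs : s * s = r ^ 2)
    (hrs : r * s = s * r⁻¹) (hns : s ∉ Subgroup.zpowers r) (hc : Nat.card G = 8) :
    Nonempty (G ≃* QuaternionGroup 2) := by
  have hr : orderOf r = 2 * 2 := hr
  let f : QuaternionGroup 2 → G := fun x => match x with
    | .a i => r ^ i.val
    | .xa i => s * r ^ i.val
  have hf : ∀ x y, f (x * y) = f x * f y := by
    rintro (i | i) (j | j)
    · exact zpow_val_add hr i j
    · change s * r ^ (j - i).val = r ^ i.val * (s * r ^ j.val)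
      rw [zpow_val_sub hr, ← mul_assoc, ← mul_assoc, pow_swap hrs]
    · change s * r ^ (i + j).val = (s * r ^ i.val) * (r ^ j.val)
      rw [zpow_val_add hr, mul_assoc]
    · change r ^ ((2 : ZMod (2 * 2)) + j - i).val = (s * r ^ i.val) * (s * r ^ j.val)
      rw [add_sub_assoc, zpow_val_add hr, zpow_val_sub hr, mul_assoc s, ← mul_assoc _ s,
        pow_swap hrs]
      simp only [← mul_assoc]
      rw [hs]
      rfl
  let F : QuaternionGroup 2 →* G := MonoidHom.mk' f hf
  have hinj : Function.Injective F := by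
    rw [injective_iff_map_eq_one]
    rintro (i | i) h
    · change r ^ i.val = 1 at h
      rw [zpow_val_inj hr i h]; rfl
    · change s * r ^ i.val = 1 at h
      exfalso
      apply hns
      rw [mul_eq_one_iff_eq_inv] at h
      rw [h]
      exact Subgroup.inv_mem _ (Subgroup.pow_mem _ (Subgroup.mem_zpowers r) _)
  have hb : Function.Bijective F := by
    refine (Nat.bijective_iff_injective_and_card F).2 ⟨hinj, ?_⟩
    rw [hc, Nat.card_eq_fintype_card, QuaternionGroup.card]
  exact ⟨(MulEquiv.ofBijective F hb).symm⟩
end models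

section generic
variable {G : Type} [Group G] [Finite G]

theorem not_sq_dvd {p : ℕ} (hp : p.Prime) {g : G} (hg : mz g = p) : ¬ p ^ 2 ∣ Nat.card G := by
  intro h2
  have : Fact p.Prime := ⟨hp⟩
  have hpg : IsPGroup p (cz g) := IsPGroup.of_card (n := 1) (by rw [pow_one]; exact hg)
  obtain ⟨Q, hQ⟩ := hpg.exists_le_sylow
  have hQ2 : p ^ 2 ∣ Nat.card Q := Q.pow_dvd_card_of_pow_dvd_card h2
  have hnt : Nontrivial Q := by
    rw [← Finite.one_lt_card_iff_nontrivial]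
    exact lt_of_lt_of_le (Nat.one_lt_pow two_ne_zero hp.one_lt) (Nat.le_of_dvd Nat.card_pos hQ2)
  have hz := Q.isPGroup'.center_nontrivial
  obtain ⟨z, hz1⟩ := exists_ne (1 : Subgroup.center Q)
  have hcomm : ∀ y ∈ Q, y * (z.1.1 : G) = z.1.1 * y := by
    intro y hy
    have := Subgroup.mem_center_iff.1 z.2 ⟨y, hy⟩
    exact congrArg Subtype.val this
  have hzg : (z.1.1 : G) ∈ cz g := mem_cz_comm.1 (mem_cz.2 (hcomm g (hQ (self_mem_cz g))))
  have hz1' : (⟨z.1.1, hzg⟩ : cz g) ≠ 1 := by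
    intro h
    apply hz1
    have h' : (z.1.1 : G) = 1 := Subtype.ext_iff.mp h
    exact Subtype.ext (Subtype.ext h')
  have hmem := mem_zpowers_of_prime_card (p := p) hg hz1' (g' := ⟨g, self_mem_cz g⟩)
  obtain ⟨k, hk⟩ := hmem
  have hk' : (z.1.1 : G) ^ k = g := congrArg Subtype.val hk
  have hle : (Q : Subgroup G) ≤ cz g := by
    intro y hy
    rw [mem_cz, ← hk']
    exact (Commute.zpow_right (hcomm y hy) k)
  have hd := (hQ2.trans (Subgroup.card_dvd_of_le hle))
  change p ^ 2 ∣ mz g at hd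
  rw [hg] at hd
  have := Nat.le_of_dvd hp.pos hd
  nlinarith [hp.two_le]

theorem three_classes {g : G} (hg : g ≠ 1) (h : ¬ IsPrimePow (mz g)) :
    ∃ x y z : G, ¬ IsConj x y ∧ ¬ IsConj x z ∧ ¬ IsConj y z ∧ x ≠ 1 ∧ y ≠ 1 ∧ z ≠ 1 ∧
      ¬ IsPrimePow (mz x) ∧ ¬ IsPrimePow (mz y) ∧ ¬ IsPrimePow (mz z) := by
  obtain ⟨p, hp, hpd⟩ := Nat.exists_prime_and_dvd (n := orderOf g) (by simpa using hg)
  obtain ⟨q, hq, hqd, hpq⟩ : ∃ q, q.Prime ∧ q ∣ mz g ∧ q ≠ p := by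
    by_contra hcon
    push Not at hcon
    exact h (isPrimePow_iff_unique_prime_dvd.2
      ⟨p, ⟨hp, hpd.trans (orderOf_dvd_mz g)⟩, fun q hq => hcon q hq.1 hq.2⟩)
  have : Fact q.Prime := ⟨hq⟩
  obtain ⟨y, hy⟩ := exists_prime_orderOf_dvd_card' (G := cz g) q hqd
  have hx : orderOf (g ^ (orderOf g / p)) = p :=
    orderOf_pow_orderOf_div (orderOf_pos g).ne' hpd
  have hy' : orderOf (y : G) = q := by rw [Subgroup.orderOf_coe, hy]
  set x := g ^ (orderOf g / p)
  have hc : Commute x (y : G) := by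
    have : Commute g (y : G) := (mem_cz.1 y.2).symm
    exact this.pow_left _
  have hxy : orderOf (x * y) = p * q := by
    rw [hc.orderOf_mul_eq_mul_orderOf_of_coprime, hx, hy']
    rw [hx, hy']
    exact (Nat.coprime_primes hp hq).2 hpq.symm
  have key : ∀ w : G, Commute x w → Commute (y : G) w → ¬ IsPrimePow (mz w) := by
    intro w h1 h2 hpp
    obtain ⟨r, -, hr⟩ := isPrimePow_iff_unique_prime_dvd.1 hpp
    have e1 := hr p ⟨hp, hx ▸ orderOf_dvd_mz' (mem_cz.2 h1)⟩
    have e2 := hr q ⟨hq, hy' ▸ orderOf_dvd_mz' (mem_cz.2 h2)⟩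
    exact hpq (e2.trans e1.symm)
  have hord : ∀ u v : G, IsConj u v → orderOf u = orderOf v := by
    intro u v huv
    obtain ⟨k, rfl⟩ := isConj_iff.1 huv
    have : orderOf (MulAut.conj k u) = orderOf u := MulEquiv.orderOf_eq (MulAut.conj k) u
    rw [← this]; rfl
  have p2 := hp.two_le
  have q2 := hq.two_le
  have hne1 : ∀ u : G, 2 ≤ orderOf u → u ≠ 1 := by
    rintro u hu rfl
    rw [orderOf_one] at hu; omega
  refine ⟨x, y, x * y, ?_, ?_, ?_, hne1 _ (by omega), hne1 _ (by omega), hne1 _ (by nlinarith),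
    key _ (Commute.refl x) hc.symm, key _ hc (Commute.refl _),
    key _ ((Commute.refl x).mul_right hc) (hc.symm.mul_right (Commute.refl _))⟩
  · intro hh
    have := hord _ _ hh
    omega
  · intro hh
    have := hord _ _ hh
    nlinarith
  · intro hh
    have := hord _ _ hh
    nlinarith

theorem prime_pows {a b c d : G} (F : Five G a b c d) (ha : IsPrimePow (mz a))
    (hb : IsPrimePow (mz b)) : IsPrimePow (mz c) ∧ IsPrimePow (mz d) := by
  have key : ∀ g : G, g ≠ 1 → IsPrimePow (mz g) := by
    intro g hg
    by_contra hcon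
    obtain ⟨x, y, z, hxy, hxz, hyz, hx, hy, hz, px, py, pz⟩ := three_classes hg hcon
    have aux : ∀ w : G, w ≠ 1 → ¬ IsPrimePow (mz w) → IsConj c w ∨ IsConj d w := by
      intro w hw hpw
      rcases F.cover w hw with h | h | h | h
      · rw [← mz_conj h] at hpw; exact absurd ha hpw
      · rw [← mz_conj h] at hpw; exact absurd hb hpw
      · exact Or.inl h
      · exact Or.inr h
    rcases aux x hx px with h1 | h1 <;> rcases aux y hy py with h2 | h2 <;>
      rcases aux z hz pz with h3 | h3 <;>
      first
      | exact hxy (h1.symm.trans h2)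
      | exact hxz (h1.symm.trans h3)
      | exact hyz (h2.symm.trans h3)
  exact ⟨key c F.c1, key d F.d1⟩

/-- If `P = C(g)` is abelian and all its nontrivial elements are conjugate to `g`, then
`|N(P)| = |P| (|P| - 1)`. -/
theorem normalizer_card {g : G} (hcomm : ∀ x ∈ cz g, ∀ y ∈ cz g, x * y = y * x)
    (hconj : ∀ y ∈ cz g, y ≠ 1 → IsConj g y) (hg : g ≠ 1) :
    Nat.card (Subgroup.normalizer (cz g : Set G)) = (mz g - 1) * mz g := by
  have h := conj_orbit (Subgroup.normalizer (cz g : Set G)) g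
  have hle : cz g ≤ Subgroup.normalizer (cz g : Set G) := Subgroup.le_normalizer
  rw [inf_eq_right.2 hle] at h
  rw [← h]
  congr 1
  have : {y | ∃ h ∈ Subgroup.normalizer (cz g : Set G), h * g * h⁻¹ = y} = (cz g : Set G) \ {1} := by
    ext y
    simp only [Set.mem_ofPred_eq, Set.mem_sdiff, SetLike.mem_coe, Set.mem_singleton_iff]
    constructor
    · rintro ⟨k, hk, rfl⟩
      refine ⟨(Subgroup.mem_normalizer_iff.1 hk g).1 (self_mem_cz g), ?_⟩
      intro h1
      apply hg
      rw [mul_inv_eq_one] at h1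
      simpa using h1
    · rintro ⟨hy, hy1⟩
      obtain ⟨k, hk⟩ := isConj_iff.1 (hconj y hy hy1)
      refine ⟨k, ?_, hk⟩
      have hle2 : cz g ≤ cz y := fun x hx => mem_cz.2 (hcomm x hx y hy)
      have heq : cz g = cz y := by
        apply Subgroup.eq_of_le_of_card_ge hle2
        exact (mz_conj (hconj y hy hy1)).ge
      rw [Subgroup.mem_normalizer_iff]
      intro x
      conv_rhs => rw [heq]
      rw [mem_cz, mem_cz, ← hk]
      constructor
      · intro hx
        calc k * x * k⁻¹ * (k * g * k⁻¹) = k * (x * g) * k⁻¹ := by group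
          _ = _ := by rw [hx]; group
      · intro hx
        have h1 : k * (x * g) * k⁻¹ = k * (g * x) * k⁻¹ := by
          calc k * (x * g) * k⁻¹ = k * x * k⁻¹ * (k * g * k⁻¹) := by group
            _ = _ := by rw [hx]; group
        simpa using h1
  rw [this, Set.ncard_sdiff_singleton_of_mem (one_mem (cz g))]
  rfl
end generic


section casetwo
variable {G : Type} [Group G] [Finite G]

theorem exists_index_two {t : G} (h2 : mz t = 2) :
    ∃ N : Subgroup G, N.index = 2 ∧ ¬ 2 ∣ Nat.card N := by
  have h4 : ¬ 2 ^ 2 ∣ Nat.card G := not_sq_dvd Nat.prime_two h2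
  have hd : 2 ∣ Nat.card G := h2 ▸ Subgroup.card_subgroup_dvd_card (cz t)
  let Q : Sylow 2 G := default
  have hQ : Nat.card Q = 2 := by
    obtain ⟨k, hk⟩ := Q.isPGroup'.exists_card_eq
    have h1 : 2 ∣ Nat.card Q := Q.dvd_card_of_dvd_card hd
    have h3 : Nat.card Q ∣ Nat.card G := Subgroup.card_subgroup_dvd_card _
    rcases k with _ | _ | k
    · rw [hk] at h1; omega
    · rw [hk]; rfl
    · exfalso
      apply h4
      refine dvd_trans ?_ h3
      rw [hk]
      exact pow_dvd_pow 2 (by omega)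
  have hcyc : IsCyclic Q := isCyclic_of_prime_card hQ
  have hmin : (Nat.card G).minFac = 2 := (Nat.minFac_eq_two_iff _).2 hd
  have hcomp := hcyc.isComplement' hmin
  refine ⟨_, hcomp.symm.index_eq_card.trans hQ, ?_⟩
  have h5 := hcomp.card_mul_card
  intro h6
  apply h4
  rw [← h5]
  exact mul_dvd_mul h6 (by rw [show Nat.card (Q : Subgroup G) = 2 from hQ])

theorem case_two {a b c d : G} (F : Five G a b c d) (h2 : mz a = 2) :
    Nonempty (G ≃* DihedralGroup 7) := by
  obtain ⟨N, hi, hodd⟩ := exists_index_two h2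
  have hn : Nat.card N * 2 = Nat.card G := by rw [← hi]; exact N.card_mul_index
  have ha2 : a * a = 1 := by
    have h1 := orderOf_dvd_mz a
    rw [h2] at h1
    have := orderOf_dvd_iff_pow_eq_one.1 h1
    rwa [pow_two] at this
  have hsq : ∀ y, IsConj a y → y * y = 1 := by
    intro y hy
    obtain ⟨k, rfl⟩ := isConj_iff.1 hy
    calc k * a * k⁻¹ * (k * a * k⁻¹) = k * (a * a) * k⁻¹ := by group
      _ = 1 := by rw [ha2]; group
  have hnot : ∀ y, IsConj a y → y ∉ N := by
    intro y hy hyN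
    have h1 : orderOf y = 2 := by
      refine orderOf_eq_prime (by rw [pow_two, hsq y hy]) ?_
      rintro rfl
      exact F.a1 (isConj_one_left.1 hy)
    apply hodd
    rw [← h1]
    have := orderOf_dvd_natCard (⟨y, hyN⟩ : N)
    rwa [Subgroup.orderOf_mk] at this
  have hcl := class_card a
  rw [h2, ← hn] at hcl
  have hcl' : {y | IsConj a y}.ncard = Nat.card N := by omega
  have hcompl : (N : Set G)ᶜ.ncard = Nat.card N := by
    have h1 := Set.ncard_add_ncard_compl (N : Set G)
    have h3 : (N : Set G).ncard = Nat.card N := rfl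
    omega
  have heq : {y | IsConj a y} = (N : Set G)ᶜ := by
    apply Set.eq_of_subset_of_ncard_le
    · intro y hy; exact hnot y hy
    · rw [hcl', hcompl]
    · exact Set.toFinite _
  have hout : ∀ y, y ∉ N → IsConj a y := by
    intro y hy
    have : y ∈ {y | IsConj a y} := by rw [heq]; exact hy
    exact this
  have haN : a ∉ N := hnot a (IsConj.refl a)
  have hinv : ∀ x ∈ N, x * a = a * x⁻¹ := by
    intro x hx
    have h1 : a * x ∉ N := by
      intro h
      exact haN ((N.mul_mem_cancel_right hx).1 h)
    have h3 := hsq _ (hout _ h1)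
    have h4 : a * (a * x * (a * x)) = a := by rw [h3, mul_one]
    simp only [← mul_assoc] at h4
    rw [ha2, one_mul] at h4
    rw [eq_mul_inv_iff_mul_eq, h4]
  have hcomm : ∀ x ∈ N, ∀ y ∈ N, x * y = y * x := by
    intro x hx y hy
    have h1 := hinv _ (N.mul_mem hx hy)
    rw [mul_assoc, hinv y hy, ← mul_assoc, hinv x hx, mul_assoc, mul_right_inj] at h1
    rw [← mul_inv_rev, inv_inj] at h1
    exact h1.symm
  have hcz : ∀ x, x ≠ 1 → ¬ IsConj a x → {y | IsConj x y}.ncard = 2 := by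
    intro x hx1 hx
    have hxN : x ∈ N := by
      by_contra h
      exact hx (hout x h)
    have h1 : cz x = N := by
      apply le_antisymm
      · intro y hy
        by_contra hyN
        have h3 : mz y = 2 := by rw [← h2]; exact (mz_conj (hout y hyN)).symm
        have h4 : orderOf x ∣ mz y := orderOf_dvd_mz' (mem_cz_comm.1 hy)
        rw [h3] at h4
        have h5 : orderOf x ∣ Nat.card N := by
          have := orderOf_dvd_natCard (⟨x, hxN⟩ : N)
          rwa [Subgroup.orderOf_mk] at this
        rcases (Nat.dvd_prime Nat.prime_two).1 h4 with h | h
        · exact hx1 (orderOf_eq_one_iff.1 h)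
        · rw [h] at h5; exact hodd h5
      · intro y hy
        exact mem_cz.2 (hcomm y hy x hxN)
    have h3 := class_card x
    have h4 : mz x = Nat.card N := by rw [mz, h1]
    rw [h4, ← hn, mul_comm] at h3
    exact Nat.eq_of_mul_eq_mul_left Nat.card_pos h3
  have hs := F.sum
  rw [hcl', hcz b F.b1 F.ab, hcz c F.c1 F.ac, hcz d F.d1 F.ad] at hs
  have h7 : Nat.card N = 7 := by omega
  have hbN : b ∈ N := by
    by_contra h
    exact F.ab (hout b h)
  have hb7 : orderOf b = 7 := by
    have : orderOf b ∣ 7 := by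
      have := orderOf_dvd_natCard (⟨b, hbN⟩ : N)
      rwa [Subgroup.orderOf_mk, h7] at this
    rcases (Nat.dvd_prime (by norm_num)).1 this with h | h
    · exact absurd (orderOf_eq_one_iff.1 h) F.b1
    · exact h
  refine dihedral_of b a hb7 ha2 (hinv b hbN) ?_ (by omega)
  intro h
  apply haN
  exact (Subgroup.zpowers_le.2 hbN) h
end casetwo

section enum
def enumList : List (ℕ × ℕ × ℕ × ℕ × ℕ) :=
  [
      (3,3,4,13,156), (3,3,4,14,84), (3,3,4,15,60), (3,3,4,16,48), (3,3,4,18,36),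
      (3,3,4,24,24), (3,3,5,8,120), (3,3,5,9,45), (3,3,5,10,30), (3,3,5,15,15),
      (3,3,6,7,42), (3,3,6,8,24), (3,3,6,9,18), (3,3,6,12,12), (3,3,7,7,21),
      (3,3,9,9,9), (3,4,4,8,24), (3,4,4,12,12), (3,4,5,5,60), (3,4,6,6,12),
      (3,5,5,5,15), (3,6,6,6,6), (4,4,4,5,20), (4,4,4,6,12), (4,4,4,8,8),
      (5,5,5,5,5)]

def enumN (a b c d : ℕ) : ℕ :=
  a * b * c * d / (a * b * c * d - (b * c * d + a * c * d + a * b * d + a * b * c))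

def enumPre (a b c d n : ℕ) : Bool :=
  decide (3 ≤ a) && decide (a ≤ b) && decide (b ≤ c) && decide (c ≤ d) &&
  decide (b * c * d + a * c * d + a * b * d + a * b * c < a * b * c * d) &&
  decide (n * (b * c * d + a * c * d + a * b * d + a * b * c) + a * b * c * d =
      n * (a * b * c * d)) &&
  decide (n % a = 0) && decide (n % b = 0) && decide (n % c = 0) && decide (n % d = 0)

def enumCheck (a b c d : ℕ) : Bool :=
  !(enumPre a b c d (enumN a b c d)) || enumList.contains (a, b, c, d, enumN a b c d)

theorem enum_decide_aux : ((List.range 6).all fun a => !(Nat.ble 3 a) ||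
    (List.range 7).all fun b => !(Nat.ble a b) || (List.range 10).all fun c => !(Nat.ble b c) ||
    (List.range 25).all fun d => !(Nat.ble c d) || enumCheck a b c d) = true := by
  decide +kernel

theorem enum_decide (a : ℕ) (ha : a < 6) (b : ℕ) (hb : b < 7) (c : ℕ) (hc : c < 10) (d : ℕ)
    (hd : d < 25) (h3a : 3 ≤ a) (hab : a ≤ b) (hbc : b ≤ c) (hcd : c ≤ d)
    (h : enumPre a b c d (enumN a b c d) = true) :
    (a, b, c, d, enumN a b c d) ∈ enumList := by
  have h1 := List.all_eq_true.1 enum_decide_aux a (List.mem_range.2 ha)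
  rw [Nat.ble_eq_true_of_le h3a, Bool.not_true, Bool.false_or] at h1
  have h2 := List.all_eq_true.1 h1 b (List.mem_range.2 hb)
  rw [Nat.ble_eq_true_of_le hab, Bool.not_true, Bool.false_or] at h2
  have h3 := List.all_eq_true.1 h2 c (List.mem_range.2 hc)
  rw [Nat.ble_eq_true_of_le hbc, Bool.not_true, Bool.false_or] at h3
  have h4 := List.all_eq_true.1 h3 d (List.mem_range.2 hd)
  rw [Nat.ble_eq_true_of_le hcd, Bool.not_true, Bool.false_or] at h4
  unfold enumCheck at h4
  rw [h] at h4
  simpa using h4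

/-- The arithmetic enumeration of the class equation when all centralizers have order `≥ 3`. -/
theorem enum_aux {n a b c d sa sb sc sd : ℕ} (h3 : 3 ≤ a) (hab : a ≤ b) (hbc : b ≤ c)
    (hcd : c ≤ d) (ha : sa * a = n) (hb : sb * b = n) (hc : sc * c = n) (hd : sd * d = n)
    (hn : n = 1 + sa + sb + sc + sd) :
    (a, b, c, d, n) ∈ enumList := by
  have hpos : 0 < n := by omega
  have hsd : 0 < sd := by
    rcases Nat.eq_zero_or_pos sd with h | h
    · rw [h] at hd; omega
    · exact h
  have mono : ∀ {x y s t : ℕ}, x ≤ y → 0 < x → s * x = n → t * y = n → t ≤ s := by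
    intro x y s t hxy hx hs ht
    by_contra hlt
    push Not at hlt
    have : s * x < t * y := Nat.mul_lt_mul_of_lt_of_le hlt hxy (by omega)
    omega
  have m1 : sb ≤ sa := mono hab (by omega) ha hb
  have m2 : sc ≤ sb := mono hbc (by omega) hb hc
  have m3 : sd ≤ sc := mono hcd (by omega) hc hd
  have bd : ∀ {x s : ℕ} (K : ℕ), s * x = n → K ≤ x → s * K ≤ n := by
    intro x s K hs hK
    rw [← hs]; exact Nat.mul_le_mul_left s hK
  have ha5 : a ≤ 5 := by
    by_contra h
    have := bd 6 ha (by omega)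
    omega
  have hb6 : b ≤ 6 := by
    by_contra h
    have := bd 7 hb (by omega)
    interval_cases a <;> omega
  have hc9 : c ≤ 9 := by
    by_contra h
    have := bd 10 hc (by omega)
    interval_cases a <;> interval_cases b <;> omega
  have hd24 : d ≤ 24 := by
    by_contra h
    have := bd 25 hd (by omega)
    interval_cases a <;> interval_cases b <;> interval_cases c <;> omega
  have hcond : 24 * 0 < 1 ∧
      n * (b * c * d + a * c * d + a * b * d + a * b * c) + a * b * c * d = n * (a * b * c * d) := by
    refine ⟨by omega, ?_⟩
    have e1 : n * (b * c * d) = sa * (a * b * c * d) := by rw [← ha]; ring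
    have e2 : n * (a * c * d) = sb * (a * b * c * d) := by rw [← hb]; ring
    have e3 : n * (a * b * d) = sc * (a * b * c * d) := by rw [← hc]; ring
    have e4 : n * (a * b * c) = sd * (a * b * c * d) := by rw [← hd]; ring
    rw [mul_add, mul_add, mul_add, e1, e2, e3, e4]
    conv_rhs => rw [hn]
    ring
  have hda : a ∣ n := ⟨sa, by rw [← ha, mul_comm]⟩
  have hdb : b ∣ n := ⟨sb, by rw [← hb, mul_comm]⟩
  have hdc : c ∣ n := ⟨sc, by rw [← hc, mul_comm]⟩
  have hdd : d ∣ n := ⟨sd, by rw [← hd, mul_comm]⟩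
  have h0 : 0 < a * b * c * d := by
    have : 0 < a := by omega
    have : 0 < b := by omega
    have : 0 < c := by omega
    have : 0 < d := by omega
    positivity
  have hlt : b * c * d + a * c * d + a * b * d + a * b * c < a * b * c * d := by
    by_contra hge
    push Not at hge
    have := Nat.mul_le_mul_left n hge
    omega
  have hneq : n = enumN a b c d := by
    symm
    unfold enumN
    apply Nat.div_eq_of_eq_mul_left (by omega)
    rw [Nat.mul_sub]
    omega
  have key := enum_decide a (by omega) b (by omega) c (by omega) d (by omega) h3 hab hbc hcd
  rw [← hneq] at key
  apply key
  simp only [enumPre, Bool.and_eq_true, decide_eq_true_eq]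
  exact ⟨⟨⟨⟨⟨⟨⟨⟨⟨h3, hab⟩, hbc⟩, hcd⟩, hlt⟩, hcond.2⟩, Nat.mod_eq_zero_of_dvd hda⟩,
    Nat.mod_eq_zero_of_dvd hdb⟩, Nat.mod_eq_zero_of_dvd hdc⟩, Nat.mod_eq_zero_of_dvd hdd⟩
end enum


section kill
variable {G : Type} [Group G] [Finite G]

theorem Five.four {a b c d : G} (F : Five G a b c d) {x : G} (hx : x ≠ 1) :
    (mz x = mz a ∧ IsConj a x) ∨ (mz x = mz b ∧ IsConj b x) ∨ (mz x = mz c ∧ IsConj c x) ∨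
      (mz x = mz d ∧ IsConj d x) := by
  rcases F.cover x hx with h | h | h | h
  · exact Or.inl ⟨(mz_conj h).symm, h⟩
  · exact Or.inr (Or.inl ⟨(mz_conj h).symm, h⟩)
  · exact Or.inr (Or.inr (Or.inl ⟨(mz_conj h).symm, h⟩))
  · exact Or.inr (Or.inr (Or.inr ⟨(mz_conj h).symm, h⟩))

theorem cz_comm_of_prime {p : ℕ} (hp : p.Prime) {g : G} (hg : mz g = p) :
    ∀ x ∈ cz g, ∀ y ∈ cz g, x * y = y * x := by
  intro x hx y hy
  have : Fact p.Prime := ⟨hp⟩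
  have : IsCyclic (cz g) := isCyclic_of_prime_card hg
  have := (IsCyclic.isMulCommutative (α := cz g)).is_comm.comm (⟨x, hx⟩ : cz g) ⟨y, hy⟩
  exact congrArg Subtype.val this

/-- In a centralizer of prime order `p` all nontrivial elements have order `p`. -/
theorem orderOf_of_mem_prime {p : ℕ} (hp : p.Prime) {g y : G} (hg : mz g = p)
    (hy : y ∈ cz g) (h1 : y ≠ 1) : orderOf y = p := by
  have h := orderOf_dvd_mz' hy
  rw [hg] at h
  rcases (Nat.dvd_prime hp).1 h with h | h
  · exact absurd (orderOf_eq_one_iff.1 h) h1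
  · exact h

theorem dvd_mz_of_mem_prime {p : ℕ} (hp : p.Prime) {g y : G} (hg : mz g = p)
    (hy : y ∈ cz g) (h1 : y ≠ 1) : p ∣ mz y := by
  rw [← orderOf_of_mem_prime hp hg hy h1]
  exact orderOf_dvd_mz y

theorem normal_of_normalizer_card {H : Subgroup G}
    (h : Nat.card (Subgroup.normalizer (H : Set G)) = Nat.card G) : H.Normal := by
  rw [← Subgroup.normalizer_eq_top_iff]
  exact Subgroup.eq_top_of_card_eq _ h

theorem mem_cz_pow {p : ℕ} (hp : p.Prime) {g y : G} (hg : mz g = p) (h1 : g ≠ 1)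
    (hy : y ∈ cz g) : ∃ i : ℤ, g ^ i = y := by
  have h2 : Subgroup.zpowers g = cz g := by
    apply Subgroup.eq_of_le_of_card_ge
    · rw [Subgroup.zpowers_le]; exact self_mem_cz g
    · rw [Nat.card_zpowers, orderOf_of_mem_prime hp hg (self_mem_cz g) h1]; exact hg.le
  rw [← h2] at hy
  exact Subgroup.mem_zpowers_iff.1 hy

/-- Commutators centralize a normal subgroup of prime order. -/
theorem comm_mem_of_prime {p : ℕ} (hp : p.Prime) {g : G} (hg : mz g = p) (h1 : g ≠ 1)
    (hN : (cz g).Normal) (x y : G) : (y * x)⁻¹ * (x * y) ∈ cz g := by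
  obtain ⟨i, hi⟩ := mem_cz_pow hp hg h1 (hN.conj_mem g (self_mem_cz g) x)
  obtain ⟨j, hj⟩ := mem_cz_pow hp hg h1 (hN.conj_mem g (self_mem_cz g) y)
  have e1 : (x * y) * g * (x * y)⁻¹ = (g ^ i) ^ j := by
    rw [hi, conj_zpow, hj]; group
  have e2 : (y * x) * g * (y * x)⁻¹ = (g ^ j) ^ i := by
    rw [hj, conj_zpow, hi]; group
  have e3 : (x * y) * g * (x * y)⁻¹ = (y * x) * g * (y * x)⁻¹ := by
    rw [e1, e2, ← zpow_mul, ← zpow_mul, mul_comm]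
  rw [mem_cz]
  calc (y * x)⁻¹ * (x * y) * g = (y * x)⁻¹ * ((x * y) * g * (x * y)⁻¹) * (x * y) := by group
    _ = (y * x)⁻¹ * ((y * x) * g * (y * x)⁻¹) * (x * y) := by rw [e3]
    _ = g * ((y * x)⁻¹ * (x * y)) := by group

theorem kill_156 {a b c d : G} (F : Five G a b c d) (ha : mz a = 3) (hb : mz b = 3)
    (hc : mz c = 4) (hd : mz d = 13) (hn : Nat.card G = 156) : False := by
  have hp : Nat.Prime 13 := by norm_num
  have hN := normalizer_card (cz_comm_of_prime hp hd) (by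
    intro y hy h1
    have := dvd_mz_of_mem_prime hp hd hy h1
    rcases F.four h1 with h | h | h | h
    · omega
    · omega
    · omega
    · exact h.2) F.d1
  rw [hd] at hN
  have hnorm : (cz d).Normal := normal_of_normalizer_card (by rw [hN, hn])
  have hsub : {y | IsConj a y} ⊆ (fun z => a * z) '' (cz d : Set G) := by
    intro y hy
    obtain ⟨k, rfl⟩ := isConj_iff.1 hy
    refine ⟨a⁻¹ * (k * a * k⁻¹), ?_, by group⟩
    have := comm_mem_of_prime hp hd F.d1 hnorm (k * a) (a⁻¹ * k⁻¹)
    have := comm_mem_of_prime hp hd F.d1 hnorm (k) (a * k⁻¹)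
    have e : a⁻¹ * (k * a * k⁻¹) = (a * k⁻¹ * k)⁻¹ * (k * (a * k⁻¹)) := by group
    rw [e]; exact this
  have h1 := Set.ncard_le_ncard hsub
  have h2 : ((fun z => a * z) '' (cz d : Set G)).ncard = 13 := by
    rw [Set.ncard_image_of_injective _ (mul_right_injective a)]
    exact hd
  have h3 := class_card a
  rw [ha, hn] at h3
  omega

theorem kill_48 {a b c d : G} (F : Five G a b c d) (ha : mz a = 3) (hb : mz b = 3)
    (hc : mz c = 4) (hd : mz d = 16) (hn : Nat.card G = 48) : False := by
  have ka := class_card a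
  have kb := class_card b
  have kd := class_card d
  rw [ha, hn] at ka
  rw [hb, hn] at kb
  rw [hd, hn] at kd
  have hdis : Disjoint {y | IsConj a y} {y | IsConj b y} := by
    rw [Set.disjoint_left]
    intro y h1 h2
    exact F.ab (IsConj.trans h1 (IsConj.symm h2))
  have hu : ({y | IsConj a y} ∪ {y | IsConj b y}).ncard = 32 := by
    rw [Set.ncard_union_eq hdis]; omega
  have hcu := Set.ncard_add_ncard_compl ({y | IsConj a y} ∪ {y | IsConj b y})
  rw [hu, hn] at hcu
  have key : ∀ y, IsConj d y → (cz y : Set G) = ({y | IsConj a y} ∪ {y | IsConj b y})ᶜ := by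
    intro y hy
    have hy16 : mz y = 16 := by rw [← mz_conj hy, hd]
    refine Set.eq_of_subset_of_ncard_le ?_ ?_ (Set.toFinite _)
    · intro z hz hz2
      have hz3 : mz z = 3 := by
        rcases hz2 with h | h
        · rw [← mz_conj h, ha]
        · rw [← mz_conj h, hb]
      have hz1 : z ≠ 1 := by
        rintro rfl
        rcases hz2 with h | h
        · exact F.a1 (isConj_one_right.1 (IsConj.symm h))
        · exact F.b1 (isConj_one_right.1 (IsConj.symm h))
      have o3 := orderOf_of_mem_prime Nat.prime_three hz3 (self_mem_cz z) hz1
      have := orderOf_dvd_mz' hz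
      rw [o3, hy16] at this
      omega
    · have : (cz y : Set G).ncard = 16 := hy16
      rw [this]; omega
  have hcm : c ∈ ({y | IsConj a y} ∪ {y | IsConj b y})ᶜ := by
    rintro (h | h)
    · exact F.ac h
    · exact F.bc h
  have hsub : insert 1 (insert c {y | IsConj d y}) ⊆ (cz c : Set G) := by
    intro z hz
    rcases hz with rfl | rfl | hz
    · exact (cz c).one_mem
    · exact self_mem_cz _
    · rw [← key z hz] at hcm
      exact mem_cz_comm.1 hcm
  have h1 := Set.ncard_le_ncard hsub
  rw [Set.ncard_insert_of_notMem, Set.ncard_insert_of_notMem] at h1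
  · have : (cz c : Set G).ncard = 4 := hc
    omega
  · intro h
    exact F.cd (IsConj.symm h)
  · rintro (h | h)
    · exact F.c1 h.symm
    · exact F.d1 (isConj_one_right.1 (IsConj.symm h))

/-- If nontrivial elements of even-order centralizer are conjugate to `g`, then a centralizer of
order a power of two is elementary abelian. -/
theorem comm_of_two_pow {g : G} {k : ℕ} (hk : mz g = 2 ^ (k + 1))
    (hev : ∀ y : G, y ≠ 1 → 2 ∣ mz y → IsConj g y) :
    (∀ x ∈ cz g, ∀ y ∈ cz g, x * y = y * x) ∧ (∀ y ∈ cz g, y ≠ 1 → IsConj g y) := by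
  have h2 : ∀ y ∈ cz g, y ≠ 1 → IsConj g y := by
    intro y hy h1
    apply hev y h1
    have := orderOf_dvd_mz' hy
    rw [hk] at this
    obtain ⟨j, -, hj⟩ := (Nat.dvd_prime_pow Nat.prime_two).1 this
    rcases Nat.eq_zero_or_pos j with h | h
    · rw [h, pow_zero] at hj
      exact absurd (orderOf_eq_one_iff.1 hj) h1
    · exact (dvd_pow_self 2 h.ne').trans (hj ▸ orderOf_dvd_mz y)
  have : Fact (Nat.Prime 2) := ⟨Nat.prime_two⟩
  obtain ⟨t, ht⟩ := exists_prime_orderOf_dvd_card' (G := cz g) 2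
    (by rw [show Nat.card (cz g) = _ from hk]; exact dvd_pow_self 2 (by omega))
  have ht1 : (t : G) ≠ 1 := by
    intro h
    have : t = 1 := Subtype.ext h
    rw [this, orderOf_one] at ht
    omega
  have htt : (t : G) * t = 1 := by
    have := pow_orderOf_eq_one t
    rw [ht, pow_two] at this
    exact congrArg Subtype.val this
  have sq : ∀ y ∈ cz g, y * y = 1 := by
    intro y hy
    by_cases h1 : y = 1
    · rw [h1, one_mul]
    · obtain ⟨k, hk⟩ := isConj_iff.1 ((IsConj.symm (h2 t t.2 ht1)).trans (h2 y hy h1))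
      rw [← hk]
      calc k * t * k⁻¹ * (k * t * k⁻¹) = k * (t * t) * k⁻¹ := by group
        _ = 1 := by rw [htt]; group
  refine ⟨?_, h2⟩
  intro x hx y hy
  have ex := inv_eq_of_mul_eq_one_left (sq x hx)
  have ey := inv_eq_of_mul_eq_one_left (sq y hy)
  have exy := inv_eq_of_mul_eq_one_left (sq _ ((cz g).mul_mem hx hy))
  rw [mul_inv_rev, ex, ey] at exy
  exact exy.symm

theorem kill_120 {a b c d : G} (F : Five G a b c d) (ha : mz a = 3) (hb : mz b = 3)
    (hc : mz c = 5) (hd : mz d = 8) (hn : Nat.card G = 120) : False := by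
  obtain ⟨h1, h2⟩ := comm_of_two_pow (g := d) (k := 2) (by rw [hd]; norm_num) (by
    intro y h1 h2
    rcases F.four h1 with h | h | h | h
    · omega
    · omega
    · omega
    · exact h.2)
  have hN := normalizer_card h1 h2 F.d1
  have h3 := Subgroup.card_subgroup_dvd_card (Subgroup.normalizer (cz d : Set G))
  rw [hN, hd, hn] at h3
  omega

theorem kill_15 {a b c d : G} (F : Five G a b c d) (ha : mz a = 3) (hb : mz b = 5)
    (hc : mz c = 5) (hd : mz d = 5) (hn : Nat.card G = 15) : False := by
  have hinv : cz a⁻¹ = cz a := by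
    ext x
    rw [mem_cz, mem_cz]
    exact Commute.inv_right_iff (a := x) (b := a)
  have hm : mz a⁻¹ = 3 := by
    rw [← ha]; exact congrArg (fun H : Subgroup G => Nat.card H) hinv
  have o3 := orderOf_of_mem_prime Nat.prime_three ha (self_mem_cz a) F.a1
  have hcj : IsConj a a⁻¹ := by
    rcases F.four (inv_ne_one.2 F.a1) with h | h | h | h
    · exact h.2
    · omega
    · omega
    · omega
  obtain ⟨k, hk⟩ := isConj_iff.1 hcj
  have hk2 : k * k * a * (k * k)⁻¹ = a := by
    calc k * k * a * (k * k)⁻¹ = k * (k * a * k⁻¹) * k⁻¹ := by group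
      _ = k * a⁻¹ * k⁻¹ := by rw [hk]
      _ = (k * a * k⁻¹)⁻¹ := by group
      _ = a := by rw [hk, inv_inv]
  have hc2 : Commute (k ^ 2) a := by
    rw [pow_two]; exact mul_inv_eq_iff_eq_mul.1 hk2
  have hc16 : Commute ((k ^ 2) ^ 8) a := hc2.pow_left 8
  have h15 : k ^ 15 = 1 := by rw [← hn]; exact pow_card_eq_one'
  have e : (k ^ 2) ^ 8 = k := by
    rw [← pow_mul, show 2 * 8 = 15 + 1 by norm_num, pow_add, h15, pow_one, one_mul]
  rw [e] at hc16
  have : a = a⁻¹ := by rw [← hk, hc16.eq]; group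
  have h2 : a ^ 2 = 1 := by rw [pow_two]; nth_rewrite 2 [this]; group
  have := orderOf_dvd_of_pow_eq_one h2
  rw [o3] at this
  omega

theorem kill_6 {a b c d : G} (F : Five G a b c d) (ha : mz a = 3) (hb : mz b = 6)
    (hc : mz c = 6) (hd : mz d = 6) (hn : Nat.card G = 6) : False := by
  have cen : ∀ y : G, mz y = 6 → y ∈ cz a := by
    intro y hy
    have : cz y = ⊤ := Subgroup.eq_top_of_card_eq _ (by rw [hn]; exact hy)
    rw [mem_cz_comm, this]
    exact Subgroup.mem_top a
  have hsub : ({1, b, c, d} : Set G) ⊆ (cz a : Set G) := by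
    rintro z (rfl | rfl | rfl | rfl)
    · exact (cz a).one_mem
    · exact cen _ hb
    · exact cen _ hc
    · exact cen _ hd
  have h1 := Set.ncard_le_ncard hsub
  have hbc : b ≠ c := fun h => F.bc (h ▸ IsConj.refl b)
  have hbd : b ≠ d := fun h => F.bd (h ▸ IsConj.refl b)
  have hcd : c ≠ d := fun h => F.cd (h ▸ IsConj.refl c)
  have h4 : ({1, b, c, d} : Set G).ncard = 4 := by
    rw [Set.ncard_insert_of_notMem, Set.ncard_insert_of_notMem, Set.ncard_pair hcd]
    · simp [hbc, hbd]
    · simp [F.b1.symm, F.c1.symm, F.d1.symm]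
  have : (cz a : Set G).ncard = 3 := ha
  omega

end kill


section construct
variable {G : Type} [Group G] [Finite G]

theorem frob_of {p m : ℕ} [Fact p.Prime] {d : G} (hd : mz d = p)
    (hN : (cz d).Normal) (hn : Nat.card G = p * m) (hpm : p.Coprime m) :
    ∃ φ : Multiplicative (ZMod m) →* MulAut (Multiplicative (ZMod p)),
      Function.Injective φ ∧
        Nonempty (G ≃* (Multiplicative (ZMod p) ⋊[φ] Multiplicative (ZMod m))) := by
  have hp : p.Prime := Fact.out
  have hidx : (cz d).index = m := by
    have h := (cz d).card_mul_index
    rw [show Nat.card (cz d) = p from hd, hn] at h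
    exact Nat.eq_of_mul_eq_mul_left hp.pos h
  obtain ⟨K, hK⟩ := Subgroup.exists_right_complement'_of_coprime (N := cz d)
    (by rw [hidx, show Nat.card (cz d) = p from hd]; exact hpm)
  have hKc : Nat.card K = m := by
    have h := hK.card_mul_card
    rw [show Nat.card (cz d) = p from hd, hn] at h
    exact Nat.eq_of_mul_eq_mul_left hp.pos h
  obtain ⟨ψ, hψ, ⟨e1⟩⟩ : ∃ ψ : K →* MulAut (cz d),
      (∀ (k : K) (x : cz d), ((ψ k x : cz d) : G) = k * x * (k : G)⁻¹) ∧
        Nonempty ((cz d) ⋊[ψ] K ≃* G) :=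
    ⟨_, fun k x => rfl, ⟨SemidirectProduct.mulEquivSubgroup hK⟩⟩
  have hinj : Function.Injective ψ := by
    rw [injective_iff_map_eq_one]
    intro k hk
    have h1 : ((ψ k) ⟨d, self_mem_cz d⟩ : cz d) = (⟨d, self_mem_cz d⟩ : cz d) := by
      rw [hk]; rfl
    have h2 : (k : G) * d * (k : G)⁻¹ = d := by
      rw [← hψ k ⟨d, self_mem_cz d⟩, h1]
    have h3 : (k : G) ∈ cz d := mem_cz.2 (mul_inv_eq_iff_eq_mul.1 h2)
    have h4 := hK.disjoint
    rw [Subgroup.disjoint_def] at h4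
    exact Subtype.ext (h4 h3 k.2)
  have hcp : IsCyclic (cz d) := isCyclic_of_prime_card (p := p) hd
  have hca : IsCyclic K := by
    let f := (IsCyclic.mulAutMulEquiv (cz d)).toMonoidHom.comp ψ
    have hf : Function.Injective f := (IsCyclic.mulAutMulEquiv (cz d)).injective.comp hinj
    have : Fact (Nat.card (cz d)).Prime := ⟨by rw [show Nat.card (cz d) = p from hd]; exact hp⟩
    exact isCyclic_of_injective f hf
  let fn : cz d ≃* Multiplicative (ZMod p) := mulEquivOfCyclicCardEq (by
    rw [show Nat.card (cz d) = p from hd, Nat.card_eq_of_bijective _ Multiplicative.toAdd.bijective,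
      Nat.card_zmod])
  let fg : K ≃* Multiplicative (ZMod m) := mulEquivOfCyclicCardEq (by
    rw [hKc, Nat.card_eq_of_bijective _ Multiplicative.toAdd.bijective, Nat.card_zmod])
  refine ⟨_, ?_, ⟨e1.symm.trans (SemidirectProduct.congr' (fn := fn) (fg := fg))⟩⟩
  exact (MulAut.congr fn).injective.comp (hinj.comp fg.symm.injective)

theorem case_20 {a b c d : G} (F : Five G a b c d) (ha : mz a = 4) (hb : mz b = 4)
    (hc : mz c = 4) (hd : mz d = 5) (hn : Nat.card G = 20) :
    ∃ φ : Multiplicative (ZMod 4) →* MulAut (Multiplicative (ZMod 5)),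
      Function.Injective φ ∧
        Nonempty (G ≃* (Multiplicative (ZMod 5) ⋊[φ] Multiplicative (ZMod 4))) := by
  have hp : Nat.Prime 5 := by norm_num
  have : Fact (Nat.Prime 5) := ⟨hp⟩
  have hN := normalizer_card (cz_comm_of_prime hp hd) (by
    intro y hy h1
    have := dvd_mz_of_mem_prime hp hd hy h1
    rcases F.four h1 with h | h | h | h
    · omega
    · omega
    · omega
    · exact h.2) F.d1
  rw [hd] at hN
  have hnorm : (cz d).Normal := normal_of_normalizer_card (by rw [hN, hn])
  exact frob_of hd hnorm hn (by norm_num)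

theorem case_21 {d : G} (hd : mz d = 7) (hn : Nat.card G = 21) :
    ∃ φ : Multiplicative (ZMod 3) →* MulAut (Multiplicative (ZMod 7)),
      φ ≠ 1 ∧
        Nonempty (G ≃* (Multiplicative (ZMod 7) ⋊[φ] Multiplicative (ZMod 3))) := by
  have : Fact (Nat.Prime 7) := ⟨by norm_num⟩
  let P : Sylow 7 G := Sylow.ofCard (cz d) (by
    rw [show Nat.card (cz d) = 7 from hd, hn, Nat.factorization_def _ (by norm_num)]
    have : padicValNat 7 21 = 1 := by
      rw [show (21 : ℕ) = 7 * 3 by norm_num, padicValNat.mul (by norm_num) (by norm_num),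
        padicValNat_self, padicValNat.eq_zero_of_not_dvd (by norm_num)]
    rw [this, pow_one])
  have h1 := card_sylow_modEq_one 7 G
  have h2 := P.card_dvd_index
  have hidx : P.index = 3 := by
    have h := (cz d).card_mul_index
    rw [show Nat.card (cz d) = 7 from hd, hn] at h
    change (cz d).index = 3
    omega
  rw [hidx] at h2
  have h3 := Nat.le_of_dvd (by norm_num) h2
  have h4 : Nat.card (Sylow 7 G) = 1 := by
    unfold Nat.ModEq at h1
    omega
  have hss : Subsingleton (Sylow 7 G) := (Nat.card_eq_one_iff_unique.1 h4).1
  have hnorm : (cz d).Normal := Sylow.normal_of_subsingleton P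
  obtain ⟨φ, h1, h2⟩ := frob_of (m := 3) hd hnorm hn (by norm_num)
  refine ⟨φ, ?_, h2⟩
  rintro rfl
  have : (Multiplicative.ofAdd (1 : ZMod 3)) = 1 := h1 rfl
  revert this
  decide

theorem case_5 (hn : Nat.card G = 5) : Nonempty (G ≃* Multiplicative (ZMod 5)) := by
  have : Fact (Nat.Prime 5) := ⟨by norm_num⟩
  exact ⟨mulEquivOfPrimeCardEq (p := 5) hn (by
    rw [Nat.card_eq_of_bijective _ Multiplicative.toAdd.bijective, Nat.card_zmod])⟩

theorem case_8 {a : G} (ha : mz a = 4) (hn : Nat.card G = 8) :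
    Nonempty (G ≃* DihedralGroup 4) ∨ Nonempty (G ≃* QuaternionGroup 2) := by
  have hnc : ¬ ∀ x y : G, x * y = y * x := by
    intro h
    have : cz a = ⊤ := by
      rw [eq_top_iff]
      intro x _
      exact mem_cz.2 (h x a)
    have h2 : mz a = 8 := by
      rw [← hn, ← Subgroup.card_top (G := G)]
      exact congrArg (fun H : Subgroup G => Nat.card H) this
    omega
  obtain ⟨r, hr2⟩ : ∃ r : G, r * r ≠ 1 := by
    by_contra hcon
    push Not at hcon
    apply hnc
    intro x y
    have ex := inv_eq_of_mul_eq_one_left (hcon x)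
    have ey := inv_eq_of_mul_eq_one_left (hcon y)
    have exy := inv_eq_of_mul_eq_one_left (hcon (x * y))
    rw [mul_inv_rev, ex, ey] at exy
    exact exy.symm
  have hr : orderOf r = 4 := by
    have h1 : orderOf r ∣ 8 := by rw [← hn]; exact orderOf_dvd_natCard r
    have h2 : orderOf r ∈ Nat.divisors 8 := Nat.mem_divisors.2 ⟨h1, by norm_num⟩
    rw [show Nat.divisors 8 = {1, 2, 4, 8} by decide] at h2
    simp only [Finset.mem_insert, Finset.mem_singleton] at h2
    rcases h2 with h | h | h | h
    · rw [orderOf_eq_one_iff] at h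
      rw [h] at hr2
      simp at hr2
    · have := pow_orderOf_eq_one r
      rw [h, pow_two] at this
      exact absurd this hr2
    · exact h
    · exfalso
      have : IsCyclic G := isCyclic_of_orderOf_eq_card r (by rw [h, hn])
      exact hnc fun x y => (IsCyclic.isMulCommutative (α := G)).is_comm.comm x y
  have hcr : Nat.card (Subgroup.zpowers r) = 4 := by rw [Nat.card_zpowers, hr]
  have hidx : (Subgroup.zpowers r).index = 2 := by
    have h := (Subgroup.zpowers r).card_mul_index
    rw [hcr, hn] at h
    omega
  obtain ⟨s, hs⟩ : ∃ s : G, s ∉ Subgroup.zpowers r := by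
    by_contra hcon
    push Not at hcon
    have : Subgroup.zpowers r = ⊤ := by rw [eq_top_iff]; exact fun x _ => hcon x
    rw [this, Subgroup.index_top] at hidx
    omega
  have htop : ∀ H : Subgroup G, r ∈ H → s ∈ H → H = ⊤ := by
    intro H h1 h2
    have hle : Subgroup.zpowers r ≤ H := by rw [Subgroup.zpowers_le]; exact h1
    have d1 := Subgroup.card_dvd_of_le hle
    have d2 := Subgroup.card_subgroup_dvd_card H
    rw [hcr] at d1
    rw [hn] at d2
    have h4 : Nat.card H ≠ 4 := by
      intro h
      have := Subgroup.eq_of_le_of_card_ge hle (by rw [h, hcr])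
      rw [this] at hs
      exact hs h2
    have := Nat.le_of_dvd (by norm_num) d2
    have hpos : 0 < Nat.card H := Nat.card_pos
    obtain ⟨t, ht⟩ := d1
    apply Subgroup.eq_top_of_card_eq
    rw [hn]
    omega
  have hnrs : ¬ s * r = r * s := by
    intro h
    have h1 := htop (cz r) (self_mem_cz r) (mem_cz.2 h)
    have h2 := htop (cz s) (mem_cz.2 h.symm) (self_mem_cz s)
    have h3 := htop (Subgroup.center G)
      (Subgroup.mem_center_iff.2 fun g => mem_cz.1 (h1 ▸ Subgroup.mem_top g))
      (Subgroup.mem_center_iff.2 fun g => mem_cz.1 (h2 ▸ Subgroup.mem_top g))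
    apply hnc
    intro x y
    have : y ∈ Subgroup.center G := h3 ▸ Subgroup.mem_top y
    exact Subgroup.mem_center_iff.1 this x
  have hnorm : (Subgroup.zpowers r).Normal := Subgroup.normal_of_index_eq_two hidx
  have hr4 : r ^ 4 = 1 := by rw [← hr]; exact pow_orderOf_eq_one r
  have hpow : ∀ x ∈ Subgroup.zpowers r, x = 1 ∨ x = r ∨ x = r ^ 2 ∨ x = r⁻¹ := by
    intro x hx
    classical
    obtain ⟨k, hk, rfl⟩ := (mem_zpowers_iff_mem_range_orderOf (x := r) (y := x)).1 hx |>
      Finset.mem_image.1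
    rw [Finset.mem_range, hr] at hk
    interval_cases k
    · simp
    · simp
    · simp
    · right; right; right
      rw [eq_inv_iff_mul_eq_one, ← pow_succ]; exact hr4
  have hsr : s * r * s⁻¹ = r⁻¹ := by
    rcases hpow _ (hnorm.conj_mem r (Subgroup.mem_zpowers r) s) with h | h | h | h
    · exfalso
      have : r = 1 := by
        rw [mul_inv_eq_one] at h
        exact mul_eq_left.1 h
      rw [this] at hr2
      simp at hr2
    · exact absurd (mul_inv_eq_iff_eq_mul.1 h) hnrs
    · exfalso
      have h1 : (s * r * s⁻¹) ^ 2 = 1 := by rw [h, ← pow_mul]; exact hr4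
      rw [conj_pow, mul_inv_eq_one] at h1
      apply hr2
      rw [← pow_two]
      exact mul_eq_left.1 h1
    · exact h
  have hrs : r * s = s * r⁻¹ := by
    have : s * r⁻¹ * s⁻¹ = r := by
      calc s * r⁻¹ * s⁻¹ = (s * r * s⁻¹)⁻¹ := by group
        _ = r := by rw [hsr, inv_inv]
    exact (mul_inv_eq_iff_eq_mul.1 this).symm
  rcases hpow _ (Subgroup.mul_self_mem_of_index_two hidx s) with h | h | h | h
  · exact Or.inl (dihedral_of r s hr h hrs hs hn)
  · exact absurd (by rw [← h]; group) hnrs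
  · exact Or.inr (quaternion_of r s hr h hrs hs hn)
  · exfalso
    apply hnrs
    rw [← inv_inv r, ← h]; group

end construct


section perm
variable {G : Type} [Group G] [Finite G]

/-- A nontrivial normal subgroup contains a whole class. -/
theorem class_subset {K : Subgroup G} (hK : K.Normal) {x : G} (hx : x ∈ K) :
    {y | IsConj x y} ⊆ (K : Set G) := by
  intro y hy
  obtain ⟨k, rfl⟩ := isConj_iff.1 hy
  exact hK.conj_mem x hx k

theorem class_lt {K : Subgroup G} (hK : K.Normal) {x : G} (hx : x ∈ K) (h1 : x ≠ 1) :
    {y | IsConj x y}.ncard + 1 ≤ Nat.card K := by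
  have hsub : insert 1 {y | IsConj x y} ⊆ (K : Set G) :=
    Set.insert_subset K.one_mem (class_subset hK hx)
  have h := Set.ncard_le_ncard hsub
  rw [Set.ncard_insert_of_notMem] at h
  · exact h
  · intro h2
    exact h1 (isConj_one_left.1 h2)

/-- The action on cosets, as a homomorphism into the permutations of `Fin k`. -/
theorem coset_hom (N : Subgroup G) {k : ℕ} (hk : N.index = k) :
    ∃ f : G →* Equiv.Perm (Fin k), f.ker ≤ N := by
  have hc : Nat.card (G ⧸ N) = k := hk
  have e : (G ⧸ N) ≃ Fin k := Finite.equivFinOfCardEq hc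
  refine ⟨(e.permCongrHom.toMonoidHom).comp (MulAction.toPermHom G (G ⧸ N)), ?_⟩
  intro x hx
  rw [MonoidHom.mem_ker] at hx
  have h1 : MulAction.toPermHom G (G ⧸ N) x = 1 := by
    apply e.permCongrHom.injective
    rw [map_one]; exact hx
  have h2 : x ∈ (MulAction.toPermHom G (G ⧸ N)).ker := h1
  rw [← Subgroup.normalCore_eq_ker] at h2
  exact N.normalCore_le h2

theorem case_24 {a b c d : G} (F : Five G a b c d) (ha : mz a = 3) (hb : mz b = 4)
    (hc : mz c = 4) (hd : mz d = 8) (hn : Nat.card G = 24) :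
    Nonempty (G ≃* Equiv.Perm (Fin 4)) := by
  have hp : Nat.Prime 3 := Nat.prime_three
  have : Fact (Nat.Prime 3) := ⟨hp⟩
  have hN := normalizer_card (cz_comm_of_prime hp ha) (by
    intro y hy h1
    have := dvd_mz_of_mem_prime hp ha hy h1
    rcases F.four h1 with h | h | h | h
    · exact h.2
    · omega
    · omega
    · omega) F.a1
  rw [ha] at hN
  have hidx : (Subgroup.normalizer (cz a : Set G)).index = 4 := by
    have h := (Subgroup.normalizer (cz a : Set G)).card_mul_index
    rw [hN, hn] at h
    omega
  obtain ⟨f, hf⟩ := coset_hom _ hidx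
  have hdvd := Subgroup.card_dvd_of_le hf
  rw [hN] at hdvd
  have hle := Nat.le_of_dvd (by norm_num) hdvd
  have hsz : ∀ x ∈ f.ker, x ≠ 1 → 3 ≤ {y | IsConj x y}.ncard := by
    intro x _ h1
    have h := class_card x
    rw [hn] at h
    rcases F.four h1 with h2 | h2 | h2 | h2
    · rw [h2.1, ha] at h; omega
    · rw [h2.1, hb] at h; omega
    · rw [h2.1, hc] at h; omega
    · rw [h2.1, hd] at h; omega
  have hker : f.ker = ⊥ := by
    rw [Subgroup.eq_bot_iff_forall]
    intro x hx
    by_contra h1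
    have h2 := class_lt (MonoidHom.normal_ker f) hx h1
    have h3 := hsz x hx h1
    have h6 : Nat.card f.ker = 6 := by
      obtain ⟨t, ht⟩ := hdvd
      have : t < 2 := by
        by_contra h
        have : Nat.card f.ker * 2 ≤ Nat.card f.ker * t := Nat.mul_le_mul_left _ (by omega)
        omega
      interval_cases t <;> omega
    obtain ⟨t, ht⟩ := exists_prime_orderOf_dvd_card' (G := f.ker) 3 (by rw [h6]; norm_num)
    rw [← Subgroup.orderOf_coe] at ht
    have ht1 : (t : G) ≠ 1 := by
      intro h
      rw [h, orderOf_one] at ht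
      omega
    have h7 := class_lt (MonoidHom.normal_ker f) t.2 ht1
    have h8 := class_card (t : G)
    have h9 := orderOf_dvd_mz (t : G)
    rw [ht] at h9
    rw [hn] at h8
    rcases F.four ht1 with h | h | h | h
    · rw [h.1, ha] at h8
      omega
    · omega
    · omega
    · omega
  have hinj : Function.Injective f := (MonoidHom.ker_eq_bot_iff f).1 hker
  have hcard : Nat.card (Equiv.Perm (Fin 4)) = 24 := by
    rw [Nat.card_eq_fintype_card, Fintype.card_perm, Fintype.card_fin]; rfl
  exact ⟨MulEquiv.ofBijective f
    ((Nat.bijective_iff_injective_and_card f).2 ⟨hinj, by rw [hn, hcard]⟩)⟩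

theorem case_60 {a b c d : G} (F : Five G a b c d) (ha : mz a = 3) (hb : mz b = 4)
    (hc : mz c = 5) (hd : mz d = 5) (hn : Nat.card G = 60) :
    Nonempty (G ≃* alternatingGroup (Fin 5)) := by
  obtain ⟨h1, h2⟩ := comm_of_two_pow (g := b) (k := 1) (by rw [hb]; norm_num) (by
    intro y h1 h2
    rcases F.four h1 with h | h | h | h
    · omega
    · exact h.2
    · omega
    · omega)
  have hN := normalizer_card h1 h2 F.b1
  rw [hb] at hN
  have hidx : (Subgroup.normalizer (cz b : Set G)).index = 5 := by
    have h := (Subgroup.normalizer (cz b : Set G)).card_mul_index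
    rw [hN, hn] at h
    omega
  obtain ⟨f, hf⟩ := coset_hom _ hidx
  have hdvd := Subgroup.card_dvd_of_le hf
  rw [hN] at hdvd
  have hle := Nat.le_of_dvd (by norm_num) hdvd
  have hker : f.ker = ⊥ := by
    rw [Subgroup.eq_bot_iff_forall]
    intro x hx
    by_contra h1
    have h2 := class_lt (MonoidHom.normal_ker f) hx h1
    have h := class_card x
    rw [hn] at h
    rcases F.four h1 with h2 | h2 | h2 | h2
    · rw [h2.1, ha] at h; omega
    · rw [h2.1, hb] at h; omega
    · rw [h2.1, hc] at h; omega
    · rw [h2.1, hd] at h; omega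
  have hinj : Function.Injective f := (MonoidHom.ker_eq_bot_iff f).1 hker
  have e := MonoidHom.ofInjective hinj
  have hrc : Nat.card f.range = 60 := by rw [← hn]; exact (Nat.card_congr e.toEquiv).symm
  have hcard : Nat.card (Equiv.Perm (Fin 5)) = 120 := by
    rw [Nat.card_eq_fintype_card, Fintype.card_perm, Fintype.card_fin]; rfl
  have hri : f.range.index = 2 := by
    have h := f.range.card_mul_index
    rw [hrc, hcard] at h
    omega
  have halt := Equiv.Perm.eq_alternatingGroup_of_index_eq_two hri
  exact ⟨e.trans (MulEquiv.subgroupCongr halt)⟩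

end perm

/-- Representatives of the conjugacy classes of `A₅`, as permutations. -/
def rP : Fin 5 → Equiv.Perm (Fin 5) :=
  ![1, Equiv.swap 0 1 * Equiv.swap 1 2, Equiv.swap 0 1 * Equiv.swap 2 3,
    Equiv.swap 0 1 * Equiv.swap 1 2 * Equiv.swap 2 3 * Equiv.swap 3 4,
    Equiv.swap 0 2 * Equiv.swap 2 1 * Equiv.swap 1 3 * Equiv.swap 3 4]

theorem rP_sign (i : Fin 5) : Equiv.Perm.sign (rP i) = 1 := by
  revert i
  decide +kernel

/-- Representatives of the conjugacy classes of `A₅`. -/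
def rA (i : Fin 5) : alternatingGroup (Fin 5) := ⟨rP i, Equiv.Perm.mem_alternatingGroup.2 (rP_sign i)⟩

theorem rP_card (i : Fin 5) :
    Fintype.card {x : Equiv.Perm (Fin 5) // x * rP i = rP i * x ∧ Equiv.Perm.sign x = 1} =
      ![60, 3, 4, 5, 5] i := by
  fin_cases i
  · have h : Nat.card (alternatingGroup (Fin 5)) = 60 := by
      rw [nat_card_alternatingGroup, Nat.card_fin]; rfl
    rw [← Nat.card_eq_fintype_card]
    refine Eq.trans (Nat.card_congr (Equiv.subtypeEquivRight fun x => ?_)) h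
    rw [Equiv.Perm.mem_alternatingGroup]
    exact ⟨fun h => h.2, fun h => ⟨(mul_one x).trans (one_mul x).symm, h⟩⟩
  all_goals decide +kernel

theorem rP_conj : ∀ x : Equiv.Perm (Fin 5), ¬ (x * rP 3 = rP 4 * x ∧ Equiv.Perm.sign x = 1) := by
  decide +kernel

theorem rA_conj : ¬ ∃ x : alternatingGroup (Fin 5), x * rA 3 * x⁻¹ = rA 4 := by
  rintro ⟨x, hx⟩
  exact rP_conj x ⟨congrArg Subtype.val (mul_inv_eq_iff_eq_mul.1 hx),
    Equiv.Perm.mem_alternatingGroup.1 x.2⟩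

theorem rA_mz (i : Fin 5) : mz (rA i) = ![60, 3, 4, 5, 5] i := by
  rw [← rP_card i, ← Nat.card_eq_fintype_card]
  refine Nat.card_congr ⟨fun y => ⟨y.1.1, congrArg Subtype.val (mem_cz.1 y.2),
    Equiv.Perm.mem_alternatingGroup.1 y.1.2⟩, fun y =>
    ⟨⟨y.1, Equiv.Perm.mem_alternatingGroup.2 y.2.2⟩, mem_cz.2 (Subtype.ext y.2.1)⟩,
    fun y => rfl, fun y => rfl⟩

theorem rA_inj : Function.Injective fun i => ConjClasses.mk (rA i) := by
  have h34 : ¬ IsConj (rA 3) (rA 4) := fun h => rA_conj (isConj_iff.1 h)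
  have key : ∀ i j : Fin 5, (![60, 3, 4, 5, 5] : Fin 5 → ℕ) i = (![60, 3, 4, 5, 5] : Fin 5 → ℕ) j →
      i = j ∨ (i = 3 ∧ j = 4) ∨ (i = 4 ∧ j = 3) := by decide
  intro i j hij
  have hc : IsConj (rA i) (rA j) := ConjClasses.mk_eq_mk_iff_isConj.1 hij
  have h := mz_conj hc
  rw [rA_mz, rA_mz] at h
  rcases key i j h with h | ⟨rfl, rfl⟩ | ⟨rfl, rfl⟩
  · exact h
  · exact (h34 hc).elim
  · exact (h34 hc.symm).elim

theorem k_a5 : Nat.card (ConjClasses (alternatingGroup (Fin 5))) = 5 := by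
  classical
  have hG : Nat.card (alternatingGroup (Fin 5)) = 60 := by
    rw [nat_card_alternatingGroup, Nat.card_fin]; rfl
  have hs := Group.sum_card_conj_classes_eq_card (alternatingGroup (Fin 5))
  have : Fintype (ConjClasses (alternatingGroup (Fin 5))) := Fintype.ofFinite _
  rw [finsum_eq_sum_of_fintype, hG] at hs
  have hcar : ∀ i, (ConjClasses.mk (rA i)).carrier.ncard = ![1, 20, 15, 12, 12] i := by
    intro i
    have h1 : (ConjClasses.mk (rA i)).carrier = {y | IsConj (rA i) y} := by
      ext y
      rw [ConjClasses.mem_carrier_iff_mk_eq, ConjClasses.mk_eq_mk_iff_isConj]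
      exact isConj_comm
    have h2 := class_card (rA i)
    rw [← h1, rA_mz, hG] at h2
    revert h2
    generalize (ConjClasses.mk (rA i)).carrier.ncard = t
    fin_cases i
    · change t * 60 = 60 → t = 1; omega
    · change t * 3 = 60 → t = 20; omega
    · change t * 4 = 60 → t = 15; omega
    · change t * 5 = 60 → t = 12; omega
    · change t * 5 = 60 → t = 12; omega
  have hsurj : Function.Surjective fun i => ConjClasses.mk (rA i) := by
    intro C
    by_contra hC
    have hsub : Finset.cons C (Finset.univ.map ⟨_, rA_inj⟩) (by
        simp only [Finset.mem_map, Finset.mem_univ, true_and]; exact hC) ⊆ Finset.univ :=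
      Finset.subset_univ _
    have h1 := Finset.sum_le_sum_of_subset (f := fun D => D.carrier.ncard) hsub
    rw [Finset.sum_cons, Finset.sum_map, hs] at h1
    simp only [Function.Embedding.coeFn_mk, hcar] at h1
    have h2 : ∑ i, (![1, 20, 15, 12, 12] : Fin 5 → ℕ) i = 60 := by
      simp [Fin.sum_univ_five]
    have h3 : 0 < C.carrier.ncard := by
      rw [Set.ncard_pos]
      obtain ⟨x, rfl⟩ := ConjClasses.exists_rep C
      exact ⟨x, ConjClasses.mem_carrier_mk⟩
    have h4 : C.carrier.ncard + ∑ i, (![1, 20, 15, 12, 12] : Fin 5 → ℕ) i ≤ 60 := h1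
    omega
  rw [← Nat.card_eq_of_bijective _ ⟨rA_inj, hsurj⟩, Nat.card_fin]

section final

theorem opt_card {G : Type} [Group G] {i : Fin 8} (h : fiveClassOptions G i) :
    Nat.card G = ![5, 8, 8, 14, 20, 21, 24, 60] i := by
  have hz : ∀ k : ℕ, Nat.card (Multiplicative (ZMod k)) = k := fun k => by
    rw [Nat.card_eq_of_bijective _ Multiplicative.toAdd.bijective, Nat.card_zmod]
  fin_cases i
  · obtain ⟨e⟩ : Nonempty (G ≃* Multiplicative (ZMod 5)) := h
    rw [Nat.card_congr e.toEquiv, hz]; rfl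
  · obtain ⟨e⟩ : Nonempty (G ≃* DihedralGroup 4) := h
    rw [Nat.card_congr e.toEquiv, DihedralGroup.nat_card]; rfl
  · obtain ⟨e⟩ : Nonempty (G ≃* QuaternionGroup 2) := h
    rw [Nat.card_congr e.toEquiv, Nat.card_eq_fintype_card, QuaternionGroup.card]; rfl
  · obtain ⟨e⟩ : Nonempty (G ≃* DihedralGroup 7) := h
    rw [Nat.card_congr e.toEquiv, DihedralGroup.nat_card]; rfl
  · obtain ⟨φ, -, ⟨e⟩⟩ : (∃ φ : Multiplicative (ZMod 4) →* MulAut (Multiplicative (ZMod 5)),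
      Function.Injective φ ∧
        Nonempty (G ≃* (Multiplicative (ZMod 5) ⋊[φ] Multiplicative (ZMod 4)))) := h
    rw [Nat.card_congr e.toEquiv, SemidirectProduct.card, hz, hz]; rfl
  · obtain ⟨φ, -, ⟨e⟩⟩ : (∃ φ : Multiplicative (ZMod 3) →* MulAut (Multiplicative (ZMod 7)),
      φ ≠ 1 ∧
        Nonempty (G ≃* (Multiplicative (ZMod 7) ⋊[φ] Multiplicative (ZMod 3)))) := h
    rw [Nat.card_congr e.toEquiv, SemidirectProduct.card, hz, hz]; rfl
  · obtain ⟨e⟩ : Nonempty (G ≃* Equiv.Perm (Fin 4)) := h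
    rw [Nat.card_congr e.toEquiv, Nat.card_eq_fintype_card, Fintype.card_perm, Fintype.card_fin]
    rfl
  · obtain ⟨e⟩ : Nonempty (G ≃* alternatingGroup (Fin 5)) := h
    rw [Nat.card_congr e.toEquiv, nat_card_alternatingGroup, Nat.card_fin]
    rfl

theorem not_d4_q8 {G : Type} [Group G] (h1 : fiveClassOptions G 1) (h2 : fiveClassOptions G 2) :
    False := by
  obtain ⟨e⟩ : Nonempty (G ≃* DihedralGroup 4) := h1
  obtain ⟨f⟩ : Nonempty (G ≃* QuaternionGroup 2) := h2
  have hq : ∀ x y : QuaternionGroup 2, x * x = 1 → x * y = y * x := by decide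
  have hd : ∀ x y : DihedralGroup 4, x * x = 1 → x * y = y * x := by
    intro x y hx
    let g := e.symm.trans f
    apply g.injective
    rw [map_mul, map_mul]
    apply hq
    rw [← map_mul, hx, map_one]
  have := hd (DihedralGroup.sr 0) (DihedralGroup.r 1) (by decide)
  revert this
  decide

theorem opt_unique {G : Type} [Group G] {i j : Fin 8} (hi : fiveClassOptions G i)
    (hj : fiveClassOptions G j) : i = j := by
  have h := (opt_card hi).symm.trans (opt_card hj)
  have key : ∀ i j : Fin 8, (![5, 8, 8, 14, 20, 21, 24, 60] : Fin 8 → ℕ) i =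
      (![5, 8, 8, 14, 20, 21, 24, 60] : Fin 8 → ℕ) j →
      i = j ∨ (i = 1 ∧ j = 2) ∨ (i = 2 ∧ j = 1) := by decide
  rcases key i j h with h | ⟨rfl, rfl⟩ | ⟨rfl, rfl⟩
  · exact h
  · exact (not_d4_q8 hi hj).elim
  · exact (not_d4_q8 hj hi).elim

theorem opt_exists {G : Type} [Group G] [Finite G] (h : Nat.card (ConjClasses G) = 5) :
    ∃ i, fiveClassOptions G i := by
  obtain ⟨a, b, c, d, F⟩ := exists_five h
  have hpos : 0 < mz a := Nat.card_pos
  have h1 : mz a ≠ 1 := by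
    intro h1
    have h2 := orderOf_dvd_mz a
    rw [h1, Nat.dvd_one, orderOf_eq_one_iff] at h2
    exact F.a1 h2
  by_cases h2 : mz a = 2
  · exact ⟨3, case_two F h2⟩
  have hmem := enum_aux (by omega) F.hab F.hbc F.hcd (class_card a) (class_card b) (class_card c)
    (class_card d) F.sum
  have p2 : IsPrimePow 4 := ⟨2, 2, Nat.prime_two.prime, by norm_num, by norm_num⟩
  have p3 : IsPrimePow 3 := Nat.prime_three.isPrimePow
  have npp : ∀ {n : ℕ} (p q : ℕ), p.Prime → q.Prime → p ≠ q → p ∣ n → q ∣ n →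
      ¬ IsPrimePow n := by
    intro n p q hp hq hpq h1 h2 hn
    obtain ⟨r, -, hr⟩ := isPrimePow_iff_unique_prime_dvd.1 hn
    exact hpq ((hr p ⟨hp, h1⟩).trans (hr q ⟨hq, h2⟩).symm)
  have n2 := Nat.prime_two
  have n3 := Nat.prime_three
  have n5 := Nat.prime_five
  have n7 : Nat.Prime 7 := by norm_num
  have k6 : ¬ IsPrimePow 6 := npp 2 3 n2 n3 (by norm_num) (by norm_num) (by norm_num)
  have k10 : ¬ IsPrimePow 10 := npp 2 5 n2 n5 (by norm_num) (by norm_num) (by norm_num)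
  have k12 : ¬ IsPrimePow 12 := npp 2 3 n2 n3 (by norm_num) (by norm_num) (by norm_num)
  have k14 : ¬ IsPrimePow 14 := npp 2 7 n2 n7 (by norm_num) (by norm_num) (by norm_num)
  have k15 : ¬ IsPrimePow 15 := npp 3 5 n3 n5 (by norm_num) (by norm_num) (by norm_num)
  have k18 : ¬ IsPrimePow 18 := npp 2 3 n2 n3 (by norm_num) (by norm_num) (by norm_num)
  have k24 : ¬ IsPrimePow 24 := npp 2 3 n2 n3 (by norm_num) (by norm_num) (by norm_num)
  have kc : IsPrimePow (mz a) → IsPrimePow (mz b) → ¬ IsPrimePow (mz c) → False :=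
    fun x y z => z (prime_pows F x y).1
  have kd : IsPrimePow (mz a) → IsPrimePow (mz b) → ¬ IsPrimePow (mz d) → False :=
    fun x y z => z (prime_pows F x y).2
  simp only [enumList, List.mem_cons, Prod.mk.injEq, List.not_mem_nil, or_false] at hmem
  rcases hmem with ⟨ha, hb, hc, hd, hn⟩ | ⟨ha, hb, hc, hd, hn⟩ | ⟨ha, hb, hc, hd, hn⟩ |
    ⟨ha, hb, hc, hd, hn⟩ | ⟨ha, hb, hc, hd, hn⟩ | ⟨ha, hb, hc, hd, hn⟩ | ⟨ha, hb, hc, hd, hn⟩ |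
    ⟨ha, hb, hc, hd, hn⟩ | ⟨ha, hb, hc, hd, hn⟩ | ⟨ha, hb, hc, hd, hn⟩ | ⟨ha, hb, hc, hd, hn⟩ |
    ⟨ha, hb, hc, hd, hn⟩ | ⟨ha, hb, hc, hd, hn⟩ | ⟨ha, hb, hc, hd, hn⟩ | ⟨ha, hb, hc, hd, hn⟩ |
    ⟨ha, hb, hc, hd, hn⟩ | ⟨ha, hb, hc, hd, hn⟩ | ⟨ha, hb, hc, hd, hn⟩ | ⟨ha, hb, hc, hd, hn⟩ |
    ⟨ha, hb, hc, hd, hn⟩ | ⟨ha, hb, hc, hd, hn⟩ | ⟨ha, hb, hc, hd, hn⟩ | ⟨ha, hb, hc, hd, hn⟩ |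
    ⟨ha, hb, hc, hd, hn⟩ | ⟨ha, hb, hc, hd, hn⟩ | ⟨ha, hb, hc, hd, hn⟩
  · exact (kill_156 F ha hb hc hd hn).elim
  · exact (kd (by rw [ha]; exact p3) (by rw [hb]; exact p3) (by rw [hd]; exact k14)).elim
  · exact (kd (by rw [ha]; exact p3) (by rw [hb]; exact p3) (by rw [hd]; exact k15)).elim
  · exact (kill_48 F ha hb hc hd hn).elim
  · exact (kd (by rw [ha]; exact p3) (by rw [hb]; exact p3) (by rw [hd]; exact k18)).elim
  · exact (kd (by rw [ha]; exact p3) (by rw [hb]; exact p3) (by rw [hd]; exact k24)).elim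
  · exact (kill_120 F ha hb hc hd hn).elim
  · exact (not_sq_dvd n3 ha (by rw [hn]; norm_num)).elim
  · exact (kd (by rw [ha]; exact p3) (by rw [hb]; exact p3) (by rw [hd]; exact k10)).elim
  · exact (kd (by rw [ha]; exact p3) (by rw [hb]; exact p3) (by rw [hd]; exact k15)).elim
  · exact (kc (by rw [ha]; exact p3) (by rw [hb]; exact p3) (by rw [hc]; exact k6)).elim
  · exact (kc (by rw [ha]; exact p3) (by rw [hb]; exact p3) (by rw [hc]; exact k6)).elim
  · exact (kc (by rw [ha]; exact p3) (by rw [hb]; exact p3) (by rw [hc]; exact k6)).elim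
  · exact (kc (by rw [ha]; exact p3) (by rw [hb]; exact p3) (by rw [hc]; exact k6)).elim
  · exact ⟨5, case_21 hd hn⟩
  · exact (not_sq_dvd n3 ha (by rw [hn]; norm_num)).elim
  · exact ⟨6, case_24 F ha hb hc hd hn⟩
  · exact (kd (by rw [ha]; exact p3) (by rw [hb]; exact p2) (by rw [hd]; exact k12)).elim
  · exact ⟨7, case_60 F ha hb hc hd hn⟩
  · exact (kc (by rw [ha]; exact p3) (by rw [hb]; exact p2) (by rw [hc]; exact k6)).elim
  · exact (kill_15 F ha hb hc hd hn).elim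
  · exact (kill_6 F ha hb hc hd hn).elim
  · exact ⟨4, case_20 F ha hb hc hd hn⟩
  · exact (kd (by rw [ha]; exact p2) (by rw [hb]; exact p2) (by rw [hd]; exact k6)).elim
  · rcases case_8 ha hn with h | h
    · exact ⟨1, h⟩
    · exact ⟨2, h⟩
  · exact ⟨0, case_5 hn⟩

end final

/-- A finite group with exactly `5` conjugacy classes is isomorphic to exactly one of the
eight groups listed in `fiveClassOptions`; conversely, each of those eight groups has
exactly `5` conjugacy classes. -/
theorem stmt_0 :
    (∀ (G : Type) [Group G] [Finite G],
        Nat.card (ConjClasses G) = 5 → ∃! i : Fin 8, fiveClassOptions G i) ∧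
    Nat.card (ConjClasses (Multiplicative (ZMod 5))) = 5 ∧
    Nat.card (ConjClasses (DihedralGroup 4)) = 5 ∧
    Nat.card (ConjClasses (QuaternionGroup 2)) = 5 ∧
    Nat.card (ConjClasses (DihedralGroup 7)) = 5 ∧
    (∀ φ : Multiplicative (ZMod 4) →* MulAut (Multiplicative (ZMod 5)),
      Function.Injective φ →
        Nat.card (ConjClasses (Multiplicative (ZMod 5) ⋊[φ] Multiplicative (ZMod 4))) = 5) ∧
    (∀ φ : Multiplicative (ZMod 3) →* MulAut (Multiplicative (ZMod 7)),
      φ ≠ 1 →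
        Nat.card (ConjClasses (Multiplicative (ZMod 7) ⋊[φ] Multiplicative (ZMod 3))) = 5) ∧
    Nat.card (ConjClasses (Equiv.Perm (Fin 4))) = 5 ∧
    Nat.card (ConjClasses (alternatingGroup (Fin 5))) = 5 := by
  refine ⟨?_, k_z5, k_d4, k_q8, k_d7, k_f20, k_f21, k_s4, k_a5⟩
  intro G _ _ h
  obtain ⟨i, hi⟩ := opt_exists h
  exact ⟨i, hi, fun j hj => opt_unique hj hi⟩
end

section
/- Let G be a finite group with exactly 4 conjugacy classes. Then G is isomorphic to exactly one of: the cyclic group Z/4, the Klein four-group Z/2 × Z/2, the dihedral group of order 10, or the alternating group A4. Conversely, each of these four groups has exactly 4 conjugacy classes. -/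
/-- The four candidate isomorphism types for a finite group with exactly `4` conjugacy
classes: `ℤ/4`, the Klein four-group `ℤ/2 × ℤ/2`, the dihedral group of order `10`, and
the alternating group `A₄`. -/
def fourClassOptions (G : Type) [Group G] : Fin 4 → Prop :=
  ![Nonempty (G ≃* Multiplicative (ZMod 4)),
    Nonempty (G ≃* (Multiplicative (ZMod 2) × Multiplicative (ZMod 2))),
    Nonempty (G ≃* DihedralGroup 5),
    Nonempty (G ≃* alternatingGroup (Fin 4))]

theorem a1 : Nat.card (ConjClasses (Multiplicative (ZMod 4))) = 4 := by
  rw [Nat.card_congr (ConjClasses.mkEquiv).symm]; simp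
theorem a2 : Nat.card (ConjClasses (Multiplicative (ZMod 2) × Multiplicative (ZMod 2))) = 4 := by
  rw [Nat.card_congr (ConjClasses.mkEquiv).symm]; simp
set_option maxRecDepth 100000 in
set_option maxHeartbeats 4000000 in
theorem a3 : Nat.card (ConjClasses (DihedralGroup 5)) = 4 := by
  rw [DihedralGroup.card_conjClasses_odd (by decide)]
set_option maxRecDepth 100000 in
set_option maxHeartbeats 4000000 in
theorem a4 : Nat.card (ConjClasses (alternatingGroup (Fin 4))) = 4 := by
  rw [Nat.card_eq_fintype_card]; decide +kernel
set_option maxHeartbeats 4000000 in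
theorem numeric (a b c n : ℕ) (ha : 0 < a) (hab : a ≤ b) (hbc : b ≤ c) (hcn : c ≤ n)
   (h : b*c*n + a*c*n+a*b*n+a*b*c = a*b*c*n) (han : a ∣ n) (hbn : b ∣ n) (hcn' : c ∣ n) :
   (a=4∧b=4∧c=4∧n=4) ∨ (a=2∧b=3∧c=7∧n=42) ∨ (a = 2 ∧ 4 ∣ n) ∨ (b = 3 ∧ 9 ∣ n) ∨ (a=2∧b=5∧c=5∧n=10) ∨ (a=2∧c=6∧n=6)∨ (a=3∧c=6∧n=6) ∨ (a=3∧b=3∧c=4∧n=12) := by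
  have hb : 0 < b := by omega
  have hc : 0 < c := by omega
  have hn : 0 < n := by omega
  have h1 : a ≤ 4 := by
    by_contra! h5
    have e1 : b*c*n*5 ≤ b*c*n*a := Nat.mul_le_mul_left _ h5
    have e2 : a*c*n ≤ b*c*n := by gcongr
    have e3 : a*b*n ≤ b*c*n := by rw [mul_comm a b]; gcongr; omega
    have e4 : a*b*c ≤ b*c*n := by rw [mul_assoc, mul_comm]; gcongr; omega
    have : 0 < b*c*n := by positivity
    nlinarith
  have h1' : a ≠ 1 := by
    rintro rfl
    have : 0 < c*n := by positivity
    nlinarith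
  have h2 : b*(a-1) ≤ 3*a := by
    obtain ⟨d, rfl⟩ : ∃ d, a = d+1 := ⟨a-1, by omega⟩
    simp only [Nat.add_sub_cancel]
    have e3 : b*n ≤ c*n := by gcongr
    have e4 : b*c ≤ c*n := by rw [mul_comm]; gcongr; omega
    have : 0 < c*n := by positivity
    by_contra! hh
    have := Nat.mul_lt_mul_of_pos_right hh this
    nlinarith
  have h3 : b ≤ 6 := by
    interval_cases a <;> omega
  have h4 : c * (a*b-a-b) ≤ 2*a*b := by
    by_contra! hh
    have e1 : a + b ≤ a * b := by interval_cases a <;> omega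
    obtain ⟨d, hd⟩ := Nat.exists_eq_add_of_le e1
    have e2 : a*b - a - b = d := by omega
    rw [e2] at hh
    have := Nat.mul_lt_mul_of_pos_right hh hn
    have e3 : a*b*c ≤ a*b*n := by gcongr
    have e4 : a*b*c*n = (a+b+d)*c*n := by rw [hd]
    nlinarith
  have h5 : c ≤ 12 := by
    interval_cases a <;> interval_cases b <;> first | omega | (exfalso; nlinarith)
  interval_cases a <;> interval_cases b <;> interval_cases c <;> omega

section four
set_option linter.unusedSectionVars false
variable {G : Type} [Group G] [Finite G]

/-- order of the centralizer -/
noncomputable def cc (g : G) : ℕ := Nat.card (Subgroup.centralizer {g} : Subgroup G)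

theorem mem_c {g h : G} : h ∈ (Subgroup.centralizer {g} : Subgroup G) ↔ g * h = h * g := by
  rw [Subgroup.mem_centralizer_singleton_iff]; exact eq_comm

theorem order_dvd_cc {g h : G} (hh : g * h = h * g) : orderOf h ∣ cc g := by
  have := Subgroup.orderOf_dvd_natCard _ (mem_c.2 hh)
  exact this

theorem order_prime {g : G} (hg : g ≠ 1) (hp : (cc g).Prime) : orderOf g = cc g := by
  rcases (Nat.dvd_prime hp).1 (order_dvd_cc (rfl : g * g = g * g)) with h | h
  · exact absurd (orderOf_eq_one_iff.1 h) hg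
  · exact h

theorem cc_mul (g : G) : (ConjClasses.mk g).carrier.ncard * cc g = Nat.card G := by
  have h := MulAction.index_stabilizer (ConjAct G) g
  rw [ConjAct.orbit_eq_carrier_conjClasses] at h
  have h2 := (MulAction.stabilizer (ConjAct G) g).index_mul_card
  rw [h] at h2
  have h3 : Nat.card (MulAction.stabilizer (ConjAct G) g) = cc g := by
    unfold cc
    rw [ConjAct.stabilizer_eq_centralizer]
    rfl
  rw [h3] at h2
  exact h2

theorem classData (h4 : Nat.card (ConjClasses G) = 4) : ∃ x y z : G, x ≠ 1 ∧ y ≠ 1 ∧ z ≠ 1 ∧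
    (∀ g, g = 1 ∨ IsConj x g ∨ IsConj y g ∨ IsConj z g) ∧
    cc y * cc z * Nat.card G + cc x * cc z * Nat.card G + cc x * cc y * Nat.card G
      + cc x * cc y * cc z = cc x * cc y * cc z * Nat.card G := by
  classical
  let e0 : ConjClasses G ≃ Fin 4 := (Finite.equivFinOfCardEq h4)
  let e : Fin 4 ≃ ConjClasses G := (Equiv.swap 0 (e0 1)).trans e0.symm
  have he : e 0 = ConjClasses.mk 1 := by
    simp [e, ConjClasses.one_eq_mk_one]
  obtain ⟨x, hx⟩ := ConjClasses.exists_rep (e 1)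
  obtain ⟨y, hy⟩ := ConjClasses.exists_rep (e 2)
  obtain ⟨z, hz⟩ := ConjClasses.exists_rep (e 3)
  have key : ∀ (i : Fin 4) (w : G), ConjClasses.mk w = e i → i ≠ 0 → w ≠ 1 := by
    rintro i w hw hi rfl
    exact hi (e.injective (hw.symm.trans he.symm))
  refine ⟨x, y, z, key 1 x hx (by decide), key 2 y hy (by decide), key 3 z hz (by decide), ?_, ?_⟩
  · intro g
    obtain ⟨i, hi⟩ := e.surjective (ConjClasses.mk g)
    fin_cases i
    · left
      have : ConjClasses.mk (1:G) = ConjClasses.mk g := he.symm.trans hi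
      rw [ConjClasses.mk_eq_mk_iff_isConj] at this
      exact (isConj_one_right.1 this)
    · exact .inr (.inl (ConjClasses.mk_eq_mk_iff_isConj.1 (hx.trans hi)))
    · exact .inr (.inr (.inl (ConjClasses.mk_eq_mk_iff_isConj.1 (hy.trans hi))))
    · exact .inr (.inr (.inr (ConjClasses.mk_eq_mk_iff_isConj.1 (hz.trans hi))))
  · have hs := Group.sum_card_conj_classes_eq_card G
    rw [← finsum_comp_equiv e, finsum_eq_sum_of_fintype, Fin.sum_univ_four, he, ← hx, ← hy, ← hz] at hs
    have h1 : (ConjClasses.mk (1:G)).carrier.ncard = 1 := by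
      rw [Set.ncard_eq_one]
      refine ⟨1, ?_⟩
      ext w
      rw [ConjClasses.mem_carrier_iff_mk_eq, ConjClasses.mk_eq_mk_iff_isConj]
      simp
    have hx' := cc_mul x
    have hy' := cc_mul y
    have hz' := cc_mul z
    rw [h1] at hs
    set n := Nat.card G
    generalize (ConjClasses.mk x).carrier.ncard = p at *
    generalize (ConjClasses.mk y).carrier.ncard = q at *
    generalize (ConjClasses.mk z).carrier.ncard = r at *
    calc _ = cc y * cc z * (p * cc x) + cc x * cc z * (q * cc y) + cc x * cc y * (r * cc z) + cc x * cc y * cc z := by rw [hx', hy', hz']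
      _ = cc x * cc y * cc z * (1 + p + q + r) := by ring
      _ = _ := by rw [hs]

theorem classData' (h4 : Nat.card (ConjClasses G) = 4) : ∃ x y z : G, x ≠ 1 ∧ y ≠ 1 ∧ z ≠ 1 ∧
    (∀ g, g = 1 ∨ IsConj x g ∨ IsConj y g ∨ IsConj z g) ∧ cc x ≤ cc y ∧ cc y ≤ cc z ∧
    cc y * cc z * Nat.card G + cc x * cc z * Nat.card G + cc x * cc y * Nat.card G
      + cc x * cc y * cc z = cc x * cc y * cc z * Nat.card G := by
  obtain ⟨x, y, z, hx, hy, hz, h, e⟩ := classData h4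
  rcases le_total (cc x) (cc y) with h1 | h1 <;> rcases le_total (cc y) (cc z) with h2 | h2 <;>
    rcases le_total (cc x) (cc z) with h3 | h3
  · exact ⟨x, y, z, hx, hy, hz, h, h1, h2, e⟩
  · exact ⟨x, y, z, hx, hy, hz, h, h1, h2, e⟩
  · exact ⟨x, z, y, hx, hz, hy, fun g => by have := h g; tauto, h3, h2, by linarith⟩
  · exact ⟨z, x, y, hz, hx, hy, fun g => by have := h g; tauto, h3, h1, by linarith⟩
  · exact ⟨y, x, z, hy, hx, hz, fun g => by have := h g; tauto, h1, h3, by linarith⟩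
  · exact ⟨y, z, x, hy, hz, hx, fun g => by have := h g; tauto, h2, h3, by linarith⟩
  · exact ⟨z, y, x, hz, hy, hx, fun g => by have := h g; tauto, h2, h1, by linarith⟩
  · exact ⟨z, y, x, hz, hy, hx, fun g => by have := h g; tauto, h2, h1, by linarith⟩

theorem no_sq {g : G} (hg : g ≠ 1) (p : ℕ) [hp : Fact p.Prime] (hc : cc g = p)
    (hn : p ^ 2 ∣ Nat.card G) : False := by
  have ho : orderOf g = p := by rw [order_prime hg (hc ▸ hp.out), hc]
  obtain ⟨K, hK, hle⟩ := Sylow.exists_subgroup_card_pow_succ (n := 1) hn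
    (H := Subgroup.zpowers g) (by rw [Nat.card_zpowers, ho, pow_one])
  have hcomm := IsPGroup.isMulCommutative_of_card_eq_prime_sq (G := K) hK
  have hgK : g ∈ K := hle (Subgroup.mem_zpowers g)
  have : K ≤ Subgroup.centralizer {g} := by
    intro k hk
    rw [mem_c]
    have := hcomm.is_comm.comm ⟨g, hgK⟩ ⟨k, hk⟩
    exact congrArg Subtype.val this
  have h2 := Subgroup.card_dvd_of_le this
  rw [hK] at h2
  change _ ∣ cc g at h2
  rw [hc] at h2
  have := Nat.le_of_dvd hp.out.pos h2
  have := hp.out.two_le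
  norm_num at *
  nlinarith

theorem central_of {z : G} (h : cc z = Nat.card G) (g : G) : z * g = g * z := by
  have := Subgroup.eq_top_of_card_eq _ h
  rw [← mem_c, this]; trivial

theorem no_central {x z : G} (hx : x ≠ 1) (hz : z ≠ 1) (hp : (cc x).Prime)
    (hzc : cc z = Nat.card G) : cc x = Nat.card G := by
  have hzc := central_of hzc
  have ho := order_prime hx hp
  have h1 : Subgroup.zpowers z = Subgroup.centralizer {x} := by
    apply Subgroup.eq_of_le_of_card_ge
    · rw [Subgroup.zpowers_le, mem_c]; exact (hzc x).symm
    · rw [Nat.card_zpowers]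
      rcases (Nat.dvd_prime hp).1 (order_dvd_cc (hzc x).symm) with h | h
      · exact absurd (orderOf_eq_one_iff.1 h) hz
      · exact h.ge
  have hxm : x ∈ Subgroup.zpowers z := by rw [h1, mem_c]
  obtain ⟨k, rfl⟩ := Subgroup.mem_zpowers_iff.1 hxm
  have : (Subgroup.centralizer {z ^ k} : Subgroup G) = ⊤ := by
    rw [Subgroup.eq_top_iff']
    intro g
    rw [mem_c]
    exact (Commute.zpow_left (hzc g) k)
  unfold cc
  rw [this, Subgroup.card_top]

theorem orderOf_eq_of_conj' (c a : G) : orderOf (c * a * c⁻¹) = orderOf a :=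
  (MulAut.conj c).orderOf_eq a

theorem orderOf_conj {a b : G} (h : IsConj a b) : orderOf b = orderOf a := by
  obtain ⟨c, rfl⟩ := isConj_iff.1 h
  exact orderOf_eq_of_conj' c a

theorem no_42 {x y z : G} (hx : x ≠ 1) (hy : y ≠ 1) (hz : z ≠ 1)
    (h : ∀ g, g = 1 ∨ IsConj x g ∨ IsConj y g ∨ IsConj z g)
    (cx : cc x = 2) (cy : cc y = 3) (cz : cc z = 7) (hn : Nat.card G = 42) : False := by
  have ox : orderOf x = 2 := by rw [order_prime hx (by rw [cx]; norm_num), cx]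
  have oy : orderOf y = 3 := by rw [order_prime hy (by rw [cy]; norm_num), cy]
  have oz : orderOf z = 7 := by rw [order_prime hz (by rw [cz]; norm_num), cz]
  have hy' : IsConj y y⁻¹ := by
    rcases h y⁻¹ with h | h | h | h
    · simp at h; exact absurd h hy
    · have := orderOf_conj h; rw [orderOf_inv] at this; omega
    · exact h
    · have := orderOf_conj h; rw [orderOf_inv] at this; omega
  have h7 : ∀ w : G, orderOf w = 7 → IsConj z w := by
    intro w hw
    rcases h w with h | h | h | h
    · subst h; simp at hw
    · have := orderOf_conj h; omega
    · have := orderOf_conj h; omega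
    · exact h
  have hs : (Subgroup.zpowers z : Set G) \ {1} = (ConjClasses.mk z).carrier := by
    apply Set.eq_of_subset_of_ncard_le
    · rintro w ⟨hw, hw1⟩
      rw [ConjClasses.mem_carrier_iff_mk_eq, eq_comm, ConjClasses.mk_eq_mk_iff_isConj]
      apply h7
      have := orderOf_dvd_of_mem_zpowers hw
      rw [oz, Nat.dvd_prime (by norm_num)] at this
      rcases this with h | h
      · exact absurd (orderOf_eq_one_iff.1 h) hw1
      · exact h
    · have h1 := cc_mul z
      rw [cz, hn] at h1
      rw [Set.ncard_sdiff_singleton_of_mem (one_mem _)]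
      have : (Subgroup.zpowers z : Set G).ncard = 7 := by
        rw [← Nat.card_coe_set_eq]
        exact (Nat.card_zpowers z).trans oz
      omega
    · exact Set.toFinite _
  have hnorm : ∀ g : G, ∃ a : ℤ, z ^ a = g * z * g⁻¹ := by
    intro g
    have : g * z * g⁻¹ ∈ (ConjClasses.mk z).carrier := by
      rw [ConjClasses.mem_carrier_iff_mk_eq, eq_comm, ConjClasses.mk_eq_mk_iff_isConj]
      exact isConj_iff.2 ⟨g, rfl⟩
    rw [← hs] at this
    exact Subgroup.mem_zpowers_iff.1 this.1
  obtain ⟨u, hu⟩ := isConj_iff.1 hy'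
  obtain ⟨a, ha⟩ := hnorm u
  obtain ⟨b, hb⟩ := hnorm y
  have e1 : y * z ^ a * y⁻¹ = z ^ (a * b) := by
    rw [mul_comm, zpow_mul, hb, conj_zpow]
  have e2 : u * z ^ b * u⁻¹ = z ^ (a * b) := by
    rw [zpow_mul, ha, conj_zpow]
  have e3 : y * z ^ (a*b) * y⁻¹ = z ^ a := by
    rw [← e2, hb, ha]
    have : u * y = y⁻¹ * u := by rw [← hu]; group
    have h2 : y * u * y = u := by rw [mul_assoc, this]; group
    calc _ = (y * u * y) * z * (y * u * y)⁻¹ := by group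
      _ = _ := by rw [h2]
  have y3 : y * y * y = 1 := by
    have := pow_orderOf_eq_one y; rw [oy] at this; rw [← this, pow_succ, pow_two]
  have e4 : y * z ^ a * y⁻¹ = z ^ a := by
    have e5 : y * z ^ a * y⁻¹ = (y * y * y) * (z ^ (a * b)) * (y * y * y)⁻¹ := by
      rw [e1, y3]; group
    rw [e5]
    have : (y * y * y) * (z ^ (a * b)) * (y * y * y)⁻¹ = y * (y * (y * z ^ (a*b) * y⁻¹) * y⁻¹) * y⁻¹ := by group
    rw [this, e3, e1, e3]
  have hd : orderOf (z ^ a) ∣ cc y := order_dvd_cc (by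
    rw [mul_inv_eq_iff_eq_mul] at e4; exact e4)
  rw [ha, cy, orderOf_eq_of_conj', oz] at hd
  omega

theorem is_D5 {x y : G} (hx : x ≠ 1) (hy : y ≠ 1) (cx : cc x = 2) (cy : cc y = 5)
    (hn : Nat.card G = 10) : Nonempty (G ≃* DihedralGroup 5) := by
  have ox : orderOf x = 2 := by rw [order_prime hx (by rw [cx]; norm_num), cx]
  have oy : orderOf y = 5 := by rw [order_prime hy (by rw [cy]; norm_num), cy]
  have hxx : x * x = 1 := by
    have := pow_orderOf_eq_one x; rwa [ox, pow_two] at this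
  have hxi : x⁻¹ = x := inv_eq_of_mul_eq_one_left hxx
  have hidx : (Subgroup.zpowers y).index = 2 := by
    have := (Subgroup.zpowers y).index_mul_card
    rw [Nat.card_zpowers, oy, hn] at this
    omega
  have hN := Subgroup.normal_of_index_eq_two hidx
  have hnc : ¬ (x * y = y * x) := by
    intro h
    have := order_dvd_cc h
    rw [oy, cx] at this
    omega
  obtain ⟨a, ha⟩ := Subgroup.mem_zpowers_iff.1 (hN.conj_mem y (Subgroup.mem_zpowers y) x)
  have haa : y ^ (a * a - 1) = 1 := by
    rw [zpow_sub, zpow_mul, ha, conj_zpow, ha, hxi, zpow_one]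
    have : x * (x * y * x) * x * y⁻¹ = (x * x) * y * (x * x) * y⁻¹ := by group
    rw [this, hxx]; group
  have h5 : (5 : ℤ) ∣ (a - 1) * (a + 1) := by
    have := orderOf_dvd_iff_zpow_eq_one.2 haa
    rw [oy] at this
    rw [show (a - 1) * (a + 1) = a * a - 1 by ring]
    exact_mod_cast this
  have hinv : x * y * x⁻¹ = y⁻¹ := by
    rcases (Int.prime_iff_natAbs_prime.2 (by norm_num) : Prime (5:ℤ)).dvd_or_dvd h5 with h | h
    · exfalso
      have : y ^ (a - 1) = 1 := orderOf_dvd_iff_zpow_eq_one.1 (by rw [oy]; exact h)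
      rw [zpow_sub_one, mul_inv_eq_one, ha, mul_inv_eq_iff_eq_mul] at this
      exact hnc this
    · have : y ^ (a + 1) = 1 := orderOf_dvd_iff_zpow_eq_one.1 (by rw [oy]; exact h)
      rw [zpow_add_one, ha] at this
      exact eq_inv_of_mul_eq_one_left this
  let p : ZMod 5 → G := fun i => y ^ i.val
  have p_add : ∀ i j, p (i + j) = p i * p j := by
    intro i j
    simp only [p]
    have := pow_mod_orderOf y (i.val + j.val)
    rw [oy] at this
    rw [ZMod.val_add, ← pow_add, this]
  have p_zero : p 0 = 1 := by simp [p]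
  have p_neg : ∀ i, p (-i) = (p i)⁻¹ := by
    intro i
    apply eq_inv_of_mul_eq_one_left
    rw [← p_add]; simp [p_zero]
  have px : ∀ i, p i * x = x * p (-i) := by
    intro i
    have h1 : x * p i * x⁻¹ = (p i)⁻¹ := by
      simp only [p]; rw [← conj_pow, hinv, inv_pow]
    rw [p_neg, ← h1, hxi]
    have : x * (x * p i * x) = (x * x) * p i * x := by group
    rw [this, hxx, one_mul]
  let f : DihedralGroup 5 →* G := MonoidHom.mk' (fun d => match d with
    | .r i => p i
    | .sr i => x * p i) (by
      rintro (i | i) (j | j)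
      · simp only [DihedralGroup.r_mul_r, p_add]
      · simp only [DihedralGroup.r_mul_sr]
        rw [← mul_assoc, px, mul_assoc, ← p_add]; congr 2; ring
      · simp only [DihedralGroup.sr_mul_r, p_add, mul_assoc]
      · simp only [DihedralGroup.sr_mul_sr]
        have : x * p i * (x * p j) = x * (p i * x) * p j := by group
        rw [this, px, ← mul_assoc, hxx, one_mul, ← p_add]; congr 1; ring)
  have hinj : Function.Injective f := by
    rw [injective_iff_map_eq_one]
    rintro (i | i) h
    · change y ^ i.val = 1 at h
      have h2 := orderOf_dvd_of_pow_eq_one h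
      rw [oy] at h2
      have h3 := ZMod.val_lt i
      have : i.val = 0 := Nat.eq_zero_of_dvd_of_lt h2 h3
      rw [ZMod.val_eq_zero] at this
      rw [this]; rfl
    · exfalso
      change x * y ^ i.val = 1 at h
      apply hnc
      rw [eq_inv_of_mul_eq_one_left h]
      exact ((Commute.refl y).pow_left _).inv_left
  have hbij : Function.Bijective f := by
    rw [Nat.bijective_iff_injective_and_card]
    exact ⟨hinj, by rw [DihedralGroup.nat_card, hn]⟩
  exact ⟨(MulEquiv.ofBijective f hbij).symm⟩

theorem is_A4 {x : G} (cx : cc x = 3) (hn : Nat.card G = 12) :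
    Nonempty (G ≃* alternatingGroup (Fin 4)) := by
  let H : Subgroup G := Subgroup.centralizer {x}
  have hH : Nat.card H = 3 := cx
  have hq : Nat.card (G ⧸ H) = 4 := by
    have := H.index_mul_card
    rw [hH, hn] at this
    change H.index = 4
    omega
  let e : (G ⧸ H) ≃ Fin 4 := Finite.equivFinOfCardEq hq
  have hcore : H.normalCore = ⊥ := by
    have hd := Subgroup.card_dvd_of_le H.normalCore_le
    rw [hH, Nat.dvd_prime (by norm_num)] at hd
    rcases hd with h | h
    · exact Subgroup.card_eq_one.1 h
    · exfalso
      have h1 : H.normalCore = H := Subgroup.eq_of_le_of_card_ge H.normalCore_le (by rw [h, hH])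
      have hN : H.Normal := by rw [← h1]; infer_instance
      have hsub : (ConjClasses.mk x).carrier ⊆ (H : Set G) := by
        intro w hw
        rw [ConjClasses.mem_carrier_iff_mk_eq, eq_comm, ConjClasses.mk_eq_mk_iff_isConj] at hw
        obtain ⟨c, rfl⟩ := isConj_iff.1 hw
        exact hN.conj_mem x (mem_c.2 rfl) c
      have h2 := Set.ncard_le_ncard hsub (Set.toFinite _)
      have h3 := cc_mul x
      rw [cx, hn] at h3
      have h4 : (H : Set G).ncard = 3 := by rw [← Nat.card_coe_set_eq]; exact hH
      omega
  let f : G →* Equiv.Perm (Fin 4) :=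
    (e.permCongrHom : Equiv.Perm (G ⧸ H) →* Equiv.Perm (Fin 4)).comp (MulAction.toPermHom G (G ⧸ H))
  have hf : Function.Injective f := by
    apply (e.permCongrHom).injective.comp
    rw [← MonoidHom.ker_eq_bot_iff, ← Subgroup.normalCore_eq_ker, hcore]
  have hr : Nat.card f.range = 12 := by
    rw [← hn]; exact (Nat.card_congr (MonoidHom.ofInjective hf).toEquiv).symm
  have hi : f.range.index = 2 := by
    have := f.range.index_mul_card
    rw [hr, Nat.card_perm, Nat.card_fin] at this
    simp [Nat.factorial] at this
    omega
  have := Equiv.Perm.eq_alternatingGroup_of_index_eq_two hi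
  exact ⟨(MonoidHom.ofInjective hf).trans (MulEquiv.subgroupCongr this)⟩

theorem klein : IsKleinFour (Multiplicative (ZMod 2) × Multiplicative (ZMod 2)) := by
  refine ⟨by simp, ?_⟩
  rw [← not_isCyclic_iff_exponent_eq_prime Nat.prime_two (by simp)]
  intro h
  obtain ⟨g, hg⟩ := h.exists_zpow_surjective
  have h1 := orderOf_eq_card_of_forall_mem_zpowers (fun x => Subgroup.mem_zpowers_iff.2 (hg x))
  have : g ^ 2 = 1 := by clear h1 hg; revert g; decide
  have := Nat.le_of_dvd (by norm_num) (orderOf_dvd_of_pow_eq_one this)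
  simp at h1
  omega

theorem is_order4 (hn : Nat.card G = 4) : Nonempty (G ≃* Multiplicative (ZMod 4)) ∨
    Nonempty (G ≃* (Multiplicative (ZMod 2) × Multiplicative (ZMod 2))) := by
  by_cases h : IsCyclic G
  · left
    exact ⟨mulEquivOfCyclicCardEq (by rw [hn]; simp)⟩
  · right
    have : IsKleinFour G := ⟨hn, (not_isCyclic_iff_exponent_eq_prime Nat.prime_two hn).1 h⟩
    have := klein
    exact IsKleinFour.nonempty_mulEquiv
end four

theorem exists_option (G : Type) [Group G] [Finite G] (h4 : Nat.card (ConjClasses G) = 4) :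
    ∃ i, fourClassOptions G i := by
  obtain ⟨x, y, z, hx, hy, hz, h, hxy, hyz, e⟩ := classData' h4
  have hdvd : ∀ g : G, cc g ∣ Nat.card G := fun g => Subgroup.card_subgroup_dvd_card _
  have hpos : 0 < cc x := Nat.card_pos
  rcases numeric (cc x) (cc y) (cc z) (Nat.card G) hpos hxy hyz
    (Nat.le_of_dvd Nat.card_pos (hdvd z)) e (hdvd x) (hdvd y) (hdvd z) with
    ⟨_, _, _, hn⟩ | ⟨h1, h2, h3, hn⟩ | ⟨h1, hn⟩ | ⟨h1, hn⟩ | ⟨h1, h2, _, hn⟩ | ⟨h1, h2, hn⟩ |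
    ⟨h1, h2, hn⟩ | ⟨h1, _, _, hn⟩
  · rcases is_order4 hn with h | h
    · exact ⟨0, h⟩
    · exact ⟨1, h⟩
  · exact (no_42 hx hy hz h h1 h2 h3 hn).elim
  · have : Fact (Nat.Prime 2) := ⟨Nat.prime_two⟩
    exact (no_sq hx 2 h1 hn).elim
  · have : Fact (Nat.Prime 3) := ⟨Nat.prime_three⟩
    exact (no_sq hy 3 h1 hn).elim
  · exact ⟨2, is_D5 hx hy h1 h2 hn⟩
  · have := no_central hx hz (by rw [h1]; norm_num) (h2.trans hn.symm)
    omega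
  · have := no_central hx hz (by rw [h1]; norm_num) (h2.trans hn.symm)
    omega
  · exact ⟨3, is_A4 h1 hn⟩

theorem card_option (G : Type) [Group G] (i : Fin 4) (h : fourClassOptions G i) :
    Nat.card G = (![4, 4, 10, 12] : Fin 4 → ℕ) i := by
  fin_cases i
  · obtain ⟨f⟩ : Nonempty (G ≃* Multiplicative (ZMod 4)) := h
    rw [Nat.card_congr f.toEquiv]; simp
  · obtain ⟨f⟩ : Nonempty (G ≃* (Multiplicative (ZMod 2) × Multiplicative (ZMod 2))) := h
    rw [Nat.card_congr f.toEquiv]; simp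
  · obtain ⟨f⟩ : Nonempty (G ≃* DihedralGroup 5) := h
    rw [Nat.card_congr f.toEquiv, DihedralGroup.nat_card]; rfl
  · obtain ⟨f⟩ : Nonempty (G ≃* alternatingGroup (Fin 4)) := h
    rw [Nat.card_congr f.toEquiv, nat_card_alternatingGroup]; simp [Nat.factorial]

theorem not_both (G : Type) [Group G] (h0 : fourClassOptions G 0) (h1 : fourClassOptions G 1) :
    False := by
  obtain ⟨f⟩ : Nonempty (G ≃* Multiplicative (ZMod 4)) := h0
  obtain ⟨g⟩ : Nonempty (G ≃* (Multiplicative (ZMod 2) × Multiplicative (ZMod 2))) := h1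
  have := klein
  exact IsKleinFour.not_isCyclic (isCyclic_of_surjective (f.symm.trans g) (f.symm.trans g).surjective)

theorem option_unique (G : Type) [Group G] (i j : Fin 4) (hi : fourClassOptions G i)
    (hj : fourClassOptions G j) : i = j := by
  have e := (card_option G i hi).symm.trans (card_option G j hj)
  fin_cases i <;> fin_cases j <;> first
    | rfl
    | exact (not_both G hi hj).elim
    | exact (not_both G hj hi).elim
    | (exfalso; simp at e)

/-- A finite group with exactly `4` conjugacy classes is isomorphic to exactly one of
`ℤ/4`, `ℤ/2 × ℤ/2`, the dihedral group of order `10`, and `A₄`; conversely, each of these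
four groups has exactly `4` conjugacy classes. -/
theorem stmt_1 :
    (∀ (G : Type) [Group G] [Finite G],
        Nat.card (ConjClasses G) = 4 → ∃! i : Fin 4, fourClassOptions G i) ∧
    Nat.card (ConjClasses (Multiplicative (ZMod 4))) = 4 ∧
    Nat.card (ConjClasses (Multiplicative (ZMod 2) × Multiplicative (ZMod 2))) = 4 ∧
    Nat.card (ConjClasses (DihedralGroup 5)) = 4 ∧
    Nat.card (ConjClasses (alternatingGroup (Fin 4))) = 4 := by
  refine ⟨?_, a1, a2, a3, a4⟩
  intro G _ _ h4
  obtain ⟨i, hi⟩ := exists_option G h4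
  exact ⟨i, hi, fun j hj => option_unique G j i hj hi⟩
end
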